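/- Second tetrahedral symmetry: for positive reals a, c with b := 1/2 − a − c > 0 and all real x, y, one has g_{a,c}(x, y) = e^{−iπ/6} · conj( g_{b,c}(x − y − 1/2, −y) ) · e^{−πiy/2}, where conj denotes complex conjugation and g_{b,c} is the function g with parameter pair (b, c). -/

import Mathlib

open Real MeasureTheory

noncomputable section

/-- `c_𝖻 = i(𝖻 + 𝖻⁻¹)/2`. -/
def cB (bb : ℝ) : ℂ := Complex.I * (bb + bb⁻¹) / 2

/-- The integrand in the definition of Faddeev's quantum dilogarithm. -/
def phiKer (bb : ℝ) (z w : ℂ) : ℂ :=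
  Complex.exp (-2 * Complex.I * z * w) /
    (4 * Complex.sinh (w * bb) * Complex.sinh (w / bb) * w)

/-- Faddeev's quantum dilogarithm on the strip `|Im z| < Im c_𝖻`, defined by the
contour integral over `ℝ + iε` with `ε = π·min(𝖻,𝖻⁻¹)/2`. -/
def PhiS (bb : ℝ) (z : ℂ) : ℂ :=
  Complex.exp (∫ t : ℝ, phiKer bb z (t + Complex.I * (π * min bb bb⁻¹ / 2)))

/-- The factor appearing in the functional equation:
`Φ_𝖻(z) = Efac 𝖻 z · Φ_𝖻(z + i𝖻)`. -/
def Efac (bb : ℝ) (z : ℂ) : ℂ := 1 + Complex.exp (2 * π * bb * (z + Complex.I * bb / 2))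

/-- Number of upward shifts by `i𝖻` needed to bring `z` into the strip. -/
def nUp (bb : ℝ) (z : ℂ) : ℕ := ⌊(-((bb + bb⁻¹) / 2) - z.im) / bb⌋₊ + 1

/-- Number of downward shifts by `i𝖻` needed to bring `z` into the strip. -/
def nDn (bb : ℝ) (z : ℂ) : ℕ := ⌊(z.im - (bb + bb⁻¹) / 2) / bb⌋₊ + 1

/-- Faddeev's quantum dilogarithm `Φ_𝖻`, extended from the strip `|Im z| < Im c_𝖻`
to all of `ℂ` as a meromorphic function by the functional equation
`Φ_𝖻(z - i𝖻/2) = (1 + e^{2π𝖻z}) Φ_𝖻(z + i𝖻/2)`. -/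
def Phi (bb : ℝ) (z : ℂ) : ℂ :=
  if z.im ≤ -((bb + bb⁻¹) / 2) then
    (∏ k ∈ Finset.range (nUp bb z), Efac bb (z + Complex.I * k * bb)) *
      PhiS bb (z + Complex.I * (nUp bb z) * bb)
  else if (bb + bb⁻¹) / 2 ≤ z.im then
    PhiS bb (z - Complex.I * (nDn bb z) * bb) /
      ∏ k ∈ Finset.range (nDn bb z), Efac bb (z - Complex.I * (k + 1) * bb)
  else PhiS bb z

/-- `ψ_{a,c}(t) = Φ_𝖻(t - 2c_𝖻(a+c))⁻¹ e^{-4πi c_𝖻 a (t - c_𝖻(a+c))} e^{-πi c_𝖻²(4(a-c)+1)/6}`. -/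
def psiF (bb a c : ℝ) (t : ℂ) : ℂ :=
  (Phi bb (t - 2 * cB bb * (a + c)))⁻¹ *
    Complex.exp (-4 * π * Complex.I * cB bb * a * (t - cB bb * (a + c))) *
    Complex.exp (-π * Complex.I * (cB bb) ^ 2 * (4 * (a - c) + 1) / 6)

/-- `ψ̄_{a,c}(t) = Φ_𝖻(t + 2c_𝖻(a+c)) e^{-4πi c_𝖻 a (t + c_𝖻(a+c))} e^{πi c_𝖻²(4(a-c)+1)/6}`. -/
def psiBar (bb a c : ℝ) (t : ℂ) : ℂ :=
  Phi bb (t + 2 * cB bb * (a + c)) *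
    Complex.exp (-4 * π * Complex.I * cB bb * a * (t + cB bb * (a + c))) *
    Complex.exp (π * Complex.I * (cB bb) ^ 2 * (4 * (a - c) + 1) / 6)

/-- `ψ̃_{a,c}(s) = ∫_ℝ ψ_{a,c}(t) e^{-2πi s t} dt`. -/
def psiT (bb a c : ℝ) (s : ℝ) : ℂ :=
  ∫ t : ℝ, psiF bb a c t * Complex.exp (-2 * π * Complex.I * s * t)

/-- `ψ̃′_{a,c}(s) = e^{-πi s²} ψ̃_{a,c}(s)`. -/
def psiT' (bb a c : ℝ) (s : ℝ) : ℂ :=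
  Complex.exp (-π * Complex.I * s ^ 2) * psiT bb a c s

/-- `g_{a,c}(s,t) = Σ_{m∈ℤ} ψ̃′_{a,c}(s+m) e^{iπ t (s+2m)}`. -/
def gW (bb a c : ℝ) (s t : ℝ) : ℂ :=
  ∑' m : ℤ, psiT' bb a c (s + m) * Complex.exp (Complex.I * π * t * (s + 2 * m))

section

open Filter Topology Set

/-- Integrability of a two-sided exponential. -/
lemma integrable_const_mul_exp_neg_mul_abs (C : ℝ) {d : ℝ} (hd : 0 < d) :
    Integrable (fun x : ℝ => C * Real.exp (-(d * |x|))) := by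
  refine Integrable.const_mul ?_ C
  rw [← integrableOn_univ, ← Iic_union_Ioi (a := (0 : ℝ))]
  refine IntegrableOn.union ?_ ?_
  · refine (integrableOn_exp_mul_Iic hd 0).congr_fun (fun x hx => ?_) measurableSet_Iic
    simp only [mem_Iic] at hx
    simp [abs_of_nonpos hx]
  · refine (integrableOn_exp_mul_Ioi (neg_lt_zero.mpr hd) 0).congr_fun (fun x hx => ?_)
      measurableSet_Ioi
    simp only [mem_Ioi] at hx
    simp [abs_of_pos hx]

lemma norm_le_exp_neg_abs {C p q s : ℝ} {k : ℝ → ℂ} (hp : ∀ x, ‖k x‖ ≤ C * Real.exp (-(p * x)))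
    (hq : ∀ x, ‖k x‖ ≤ C * Real.exp (-(q * x))) {d : ℝ} (h1 : p + d ≤ s) (h2 : s + d ≤ q) (x : ℝ) :
    ‖k x‖ * Real.exp (s * x) ≤ C * Real.exp (-(d * |x|)) := by
  have hC : 0 ≤ C := by
    have := (norm_nonneg _).trans (hp 0)
    simpa using this
  rcases le_total 0 x with hx | hx
  · calc _ ≤ C * Real.exp (-(q * x)) * Real.exp (s * x) := by gcongr; exact hq x
      _ = C * Real.exp (-(q * x) + s * x) := by rw [mul_assoc, ← Real.exp_add]
      _ ≤ _ := by
        gcongr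
        rw [abs_of_nonneg hx]
        nlinarith
  · calc _ ≤ C * Real.exp (-(p * x)) * Real.exp (s * x) := by gcongr; exact hp x
      _ = C * Real.exp (-(p * x) + s * x) := by rw [mul_assoc, ← Real.exp_add]
      _ ≤ _ := by
        gcongr
        rw [abs_of_nonpos hx]
        nlinarith

/-- The two-sided Laplace transform of `k` along the line `ℝ + iy`. -/
def lineLaplace (k : ℝ → ℂ) (y : ℝ) (s : ℂ) : ℂ :=
  ∫ x : ℝ, k x * Complex.exp (s * (x + y * Complex.I))

lemma norm_exp_mul_line (s : ℂ) (x y : ℝ) :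
    ‖Complex.exp (s * (x + y * Complex.I))‖ = Real.exp (s.re * x) * Real.exp (-(s.im * y)) := by
  rw [Complex.norm_exp, ← Real.exp_add]
  congr 1
  simp
  ring

lemma norm_kernel_mul_exp_le {C p q : ℝ} {k : ℝ → ℂ}
    (hp : ∀ x, ‖k x‖ ≤ C * Real.exp (-(p * x)))
    (hq : ∀ x, ‖k x‖ ≤ C * Real.exp (-(q * x))) (y : ℝ) {s : ℂ} {d : ℝ} (h1 : p + d ≤ s.re)
    (h2 : s.re + d ≤ q) (x : ℝ) :
    ‖k x * Complex.exp (s * (x + y * Complex.I))‖ ≤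
      C * Real.exp (-(s.im * y)) * Real.exp (-(d * |x|)) := by
  rw [norm_mul, norm_exp_mul_line, ← mul_assoc]
  calc _ ≤ C * Real.exp (-(d * |x|)) * Real.exp (-(s.im * y)) := by
        exact mul_le_mul_of_nonneg_right (norm_le_exp_neg_abs hp hq h1 h2 x) (Real.exp_pos _).le
    _ = _ := by ring

lemma integrable_lineLaplace {C p q : ℝ} {k : ℝ → ℂ} (hk : Continuous k)
    (hp : ∀ x, ‖k x‖ ≤ C * Real.exp (-(p * x)))
    (hq : ∀ x, ‖k x‖ ≤ C * Real.exp (-(q * x))) (y : ℝ) {s : ℂ} (h1 : p < s.re)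
    (h2 : s.re < q) :
    Integrable fun x : ℝ => k x * Complex.exp (s * (x + y * Complex.I)) := by
  set d := min (s.re - p) (q - s.re) with hd
  have hd0 : 0 < d := lt_min (by linarith) (by linarith)
  have hd1 : d ≤ s.re - p := min_le_left _ _
  have hd2 : d ≤ q - s.re := min_le_right _ _
  refine (integrable_const_mul_exp_neg_mul_abs (C * Real.exp (-(s.im * y))) hd0).mono'
    (by fun_prop) (ae_of_all _ fun x => ?_)
  exact norm_kernel_mul_exp_le hp hq y (by linarith) (by linarith) x

lemma norm_lineLaplace_le {C p q : ℝ} {k : ℝ → ℂ}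
    (hp : ∀ x, ‖k x‖ ≤ C * Real.exp (-(p * x)))
    (hq : ∀ x, ‖k x‖ ≤ C * Real.exp (-(q * x))) (y : ℝ) {s : ℂ} {d : ℝ} (hd : 0 < d)
    (h1 : p + d ≤ s.re) (h2 : s.re + d ≤ q) :
    ‖lineLaplace k y s‖ ≤
      (∫ x : ℝ, C * Real.exp (-(d * |x|))) * Real.exp (-(s.im * y)) := by
  rw [← integral_mul_const]
  refine norm_integral_le_of_norm_le
    ((integrable_const_mul_exp_neg_mul_abs C hd).mul_const _) (ae_of_all _ fun x => ?_)
  exact (norm_kernel_mul_exp_le hp hq y h1 h2 x).trans_eq (by ring)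

lemma hasDerivAt_lineLaplace {C p q : ℝ} {k : ℝ → ℂ} (hk : Continuous k)
    (hp : ∀ x, ‖k x‖ ≤ C * Real.exp (-(p * x)))
    (hq : ∀ x, ‖k x‖ ≤ C * Real.exp (-(q * x))) (y : ℝ) {s : ℂ} (h1 : p < s.re)
    (h2 : s.re < q) :
    HasDerivAt (lineLaplace k y)
      (∫ x : ℝ, (x + y * Complex.I) * (k x * Complex.exp (s * (x + y * Complex.I)))) s := by
  have hC : 0 ≤ C := by
    have := (norm_nonneg _).trans (hp 0)
    simpa using this
  set d := min (s.re - p) (q - s.re) / 3 with hd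
  have hd0 : 0 < d := div_pos (lt_min (by linarith) (by linarith)) (by norm_num)
  have hd1 : 3 * d ≤ s.re - p := by
    rw [hd]; linarith [min_le_left (s.re - p) (q - s.re)]
  have hd2 : 3 * d ≤ q - s.re := by
    rw [hd]; linarith [min_le_right (s.re - p) (q - s.re)]
  set M := Real.exp ((|s.im| + d) * |y|) with hM
  have key := hasDerivAt_integral_of_dominated_loc_of_deriv_le (μ := volume) (x₀ := s)
    (s := Metric.ball s d)
    (F := fun (s : ℂ) (x : ℝ) => k x * Complex.exp (s * (x + y * Complex.I)))
    (F' := fun (s : ℂ) (x : ℝ) =>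
      (x + y * Complex.I) * (k x * Complex.exp (s * (x + y * Complex.I))))
    (bound := fun x : ℝ => ((d⁻¹ + |y|) * C * M) * Real.exp (-(d * |x|)))
    (Metric.ball_mem_nhds s hd0) (Eventually.of_forall fun z => by fun_prop)
    (integrable_lineLaplace hk hp hq y h1 h2) (by fun_prop) ?_
    (integrable_const_mul_exp_neg_mul_abs _ hd0) ?_
  · exact key.2
  · refine ae_of_all _ fun x z hz => ?_
    have hz' : ‖z - s‖ < d := by simpa [dist_eq_norm] using hz
    have hre : |z.re - s.re| < d := by
      have := Complex.abs_re_le_norm (z - s); simp at this; linarith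
    have him : |z.im - s.im| < d := by
      have := Complex.abs_im_le_norm (z - s); simp at this; linarith
    rw [abs_lt] at hre
    have h3 : ‖k x * Complex.exp (z * (x + y * Complex.I))‖ ≤
        C * Real.exp (-(z.im * y)) * Real.exp (-(2 * d * |x|)) :=
      norm_kernel_mul_exp_le hp hq y (by linarith) (by linarith) x
    have h4 : ‖(x + y * Complex.I : ℂ)‖ ≤ (d⁻¹ + |y|) * Real.exp (d * |x|) := by
      have e1 : ‖(x + y * Complex.I : ℂ)‖ ≤ |x| + |y| := by
        refine (norm_add_le _ _).trans ?_
        simp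
      have e2 : d * |x| + 1 ≤ Real.exp (d * |x|) := Real.add_one_le_exp _
      have e3 : |x| ≤ d⁻¹ * Real.exp (d * |x|) := by
        rw [inv_mul_eq_div, le_div_iff₀ hd0]; linarith
      have e4 : (1 : ℝ) ≤ Real.exp (d * |x|) := by
        have : 0 ≤ d * |x| := by positivity
        linarith
      nlinarith [abs_nonneg y]
    have h5 : Real.exp (-(z.im * y)) ≤ M := by
      rw [hM]
      gcongr
      have : |z.im| ≤ |s.im| + d := by
        have := abs_sub_abs_le_abs_sub z.im s.im
        linarith
      calc -(z.im * y) ≤ |z.im * y| := neg_le_abs _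
        _ = |z.im| * |y| := abs_mul _ _
        _ ≤ _ := by gcongr
    rw [norm_mul]
    calc _ ≤ ((d⁻¹ + |y|) * Real.exp (d * |x|)) * (C * M * Real.exp (-(2 * d * |x|))) := by
          gcongr
          exact h3.trans (by gcongr)
      _ = ((d⁻¹ + |y|) * C * M) * (Real.exp (d * |x|) * Real.exp (-(2 * d * |x|))) := by ring
      _ = _ := by rw [← Real.exp_add]; ring_nf
  · refine ae_of_all _ fun x z _ => ?_
    have := ((hasDerivAt_id z).mul_const (x + y * Complex.I : ℂ)).cexp.const_mul (k x)
    exact this.congr_deriv (by simp only [id]; ring)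

/-- Cauchy's theorem on a rectangle, in the form used for shifting horizontal contours. -/
lemma intervalIntegral_line_sub {f : ℂ → ℂ} {y₁ y₂ : ℝ} (hy : y₁ ≤ y₂)
    (hf : ∀ z : ℂ, y₁ ≤ z.im → z.im ≤ y₂ → DifferentiableAt ℂ f z) (T : ℝ) :
    (∫ x in -T..T, f (x + y₁ * Complex.I)) - (∫ x in -T..T, f (x + y₂ * Complex.I)) =
      Complex.I * (∫ y in y₁..y₂, f ((-T : ℝ) + y * Complex.I)) -
        Complex.I * (∫ y in y₁..y₂, f (T + y * Complex.I)) := by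
  have := Complex.integral_boundary_rect_eq_zero_of_differentiableOn f
    ((-T : ℝ) + y₁ * Complex.I) (T + y₂ * Complex.I) (fun z hz => by
      have h2 := hz.2
      simp only [mem_preimage, Complex.add_im, Complex.ofReal_im, Complex.mul_im, Complex.ofReal_re,
        Complex.I_im, Complex.I_re, mul_one, mul_zero, add_zero, zero_add, uIcc_of_le hy,
        mem_Icc] at h2
      exact (hf z h2.1 h2.2).differentiableWithinAt)
  simp only [Complex.add_im, Complex.ofReal_im, Complex.mul_im, Complex.ofReal_re, Complex.add_re,
    Complex.mul_re, sub_zero, smul_eq_mul,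
    Complex.I_im, Complex.I_re, mul_one, mul_zero, add_zero, zero_add] at this
  linear_combination this


lemma tendsto_verticalIntegral {f : ℂ → ℂ} {y₁ y₂ : ℝ} (hy : y₁ ≤ y₂) {u : ℝ → ℝ} {c : ℂ}
    {B : ℝ → ℝ} (hB : Tendsto B atTop (𝓝 0))
    (hf : ∀ z : ℂ, y₁ ≤ z.im → z.im ≤ y₂ → ContinuousAt f z)
    (hfB : ∀ᶠ T in atTop, ∀ y : ℝ, y₁ ≤ y → y ≤ y₂ → ‖f (u T + y * Complex.I) - c‖ ≤ B T) :
    Tendsto (fun T => ∫ y in y₁..y₂, f (u T + y * Complex.I)) atTop (𝓝 ((y₂ - y₁ : ℝ) * c)) := by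
  rw [tendsto_iff_norm_sub_tendsto_zero]
  have hB' : Tendsto (fun T => B T * |y₂ - y₁|) atTop (𝓝 0) := by
    simpa using hB.mul_const |y₂ - y₁|
  refine squeeze_zero' (Eventually.of_forall fun _ => norm_nonneg _) ?_ hB'
  filter_upwards [hfB] with T hT
  have hfi : IntervalIntegrable (fun y : ℝ => f (u T + y * Complex.I)) volume y₁ y₂ := by
    refine ContinuousOn.intervalIntegrable_of_Icc hy fun y hy' => ?_
    refine ContinuousAt.continuousWithinAt ?_
    refine ContinuousAt.comp (f := fun y : ℝ => (u T + y * Complex.I : ℂ)) ?_ (by fun_prop)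
    exact hf _ (by simpa using hy'.1) (by simpa using hy'.2)
  have e : (∫ y in y₁..y₂, f (u T + y * Complex.I)) - (y₂ - y₁ : ℝ) * c =
      ∫ y in y₁..y₂, (f (u T + y * Complex.I) - c) := by
    rw [intervalIntegral.integral_sub hfi (by simp), intervalIntegral.integral_const]
    simp
  rw [e]
  refine intervalIntegral.norm_integral_le_of_norm_le_const fun y hy' => ?_
  rw [uIoc_of_le hy] at hy'
  exact hT y hy'.1.le hy'.2

/-- Shifting a horizontal contour of integration. -/
lemma integral_line_eq_of_le {f : ℂ → ℂ} {y₁ y₂ : ℝ} (hy : y₁ ≤ y₂)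
    (hf : ∀ z : ℂ, y₁ ≤ z.im → z.im ≤ y₂ → DifferentiableAt ℂ f z)
    (h1 : Integrable fun x : ℝ => f (x + y₁ * Complex.I))
    (h2 : Integrable fun x : ℝ => f (x + y₂ * Complex.I))
    {C d : ℝ} (hd : 0 < d)
    (hb : ∀ x y : ℝ, 1 ≤ |x| → y₁ ≤ y → y ≤ y₂ →
      ‖f (x + y * Complex.I)‖ ≤ C * Real.exp (-(d * |x|))) :
    ∫ x : ℝ, f (x + y₁ * Complex.I) = ∫ x : ℝ, f (x + y₂ * Complex.I) := by
  have hB : Tendsto (fun T : ℝ => C * Real.exp (-(d * T))) atTop (𝓝 0) := by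
    have : Tendsto (fun T : ℝ => Real.exp (-(d * T))) atTop (𝓝 0) :=
      Real.tendsto_exp_neg_atTop_nhds_zero.comp (tendsto_id.const_mul_atTop hd)
    simpa using this.const_mul C
  have l1 := intervalIntegral_tendsto_integral h1 tendsto_neg_atTop_atBot tendsto_id
  have l2 := intervalIntegral_tendsto_integral h2 tendsto_neg_atTop_atBot tendsto_id
  have v1 := tendsto_verticalIntegral hy (u := fun T => -T) (c := 0) hB
    (fun z h h' => (hf z h h').continuousAt) (by
      filter_upwards [eventually_ge_atTop 1] with T hT y hy1 hy2
      have := hb (-T) y (by rw [abs_neg, abs_of_pos (by linarith)]; exact hT) hy1 hy2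
      rw [abs_neg, abs_of_pos (by linarith)] at this
      simpa using this)
  have v2 := tendsto_verticalIntegral hy (u := fun T => T) (c := 0) hB
    (fun z h h' => (hf z h h').continuousAt) (by
      filter_upwards [eventually_ge_atTop 1] with T hT y hy1 hy2
      have := hb T y (by rw [abs_of_pos (by linarith)]; exact hT) hy1 hy2
      rw [abs_of_pos (by linarith)] at this
      simpa using this)
  have h3 := (l1.sub l2).sub ((v1.const_mul Complex.I).sub (v2.const_mul Complex.I))
  have h4 : Tendsto (fun _ : ℝ => (0 : ℂ)) atTop (𝓝 _) := h3.congr fun T => by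
    have := intervalIntegral_line_sub hy hf T
    simp only [id]
    rw [this]
    ring
  have h5 := tendsto_nhds_unique h4 tendsto_const_nhds
  simp only [mul_zero, sub_zero] at h5
  exact sub_eq_zero.mp h5

/-- Shifting a horizontal contour past a removable singularity at the origin. -/
lemma integral_line_eq_of_isLittleO {f : ℂ → ℂ} {y₁ y₂ : ℝ} (hy₁ : y₁ < 0) (hy₂ : 0 < y₂)
    (hf : ∀ z : ℂ, z ≠ 0 → y₁ ≤ z.im → z.im ≤ y₂ → DifferentiableAt ℂ f z) (hf0 : f 0 = 0)
    (h0 : Tendsto (fun z => z * f z) (𝓝[≠] 0) (𝓝 0))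
    (h1 : Integrable fun x : ℝ => f (x + y₁ * Complex.I))
    (h2 : Integrable fun x : ℝ => f (x + y₂ * Complex.I))
    {C d : ℝ} (hd : 0 < d)
    (hb : ∀ x y : ℝ, 1 ≤ |x| → y₁ ≤ y → y ≤ y₂ →
      ‖f (x + y * Complex.I)‖ ≤ C * Real.exp (-(d * |x|))) :
    ∫ x : ℝ, f (x + y₁ * Complex.I) = ∫ x : ℝ, f (x + y₂ * Complex.I) := by
  set g := Function.update f 0 (limUnder (𝓝[≠] 0) f) with hg
  have hgf : ∀ z, z ≠ 0 → g z = f z := fun z hz => Function.update_of_ne hz _ _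
  have hS : {z : ℂ | y₁ < z.im ∧ z.im < y₂} ∈ 𝓝 (0 : ℂ) :=
    ((isOpen_lt continuous_const Complex.continuous_im).inter
      (isOpen_lt Complex.continuous_im continuous_const)).mem_nhds (by simp [hy₁, hy₂])
  have hd0 : DifferentiableAt ℂ g 0 := by
    have := Complex.differentiableOn_update_limUnder_of_isLittleO (f := f) (c := 0) hS
      (fun z hz => (hf z hz.2 hz.1.1.le hz.1.2.le).differentiableWithinAt) (by
        rw [hf0]
        refine (Asymptotics.isLittleO_iff_tendsto' ?_).mpr ?_
        · filter_upwards [self_mem_nhdsWithin] with z hz h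
          simp only [sub_zero, inv_eq_zero] at h
          exact absurd h hz
        · refine h0.congr fun z => ?_
          simp [mul_comm])
    exact this.differentiableAt hS
  have hd' : ∀ z : ℂ, y₁ ≤ z.im → z.im ≤ y₂ → DifferentiableAt ℂ g z := by
    intro z hz1 hz2
    by_cases hz : z = 0
    · rw [hz]; exact hd0
    · refine (hf z hz hz1 hz2).congr_of_eventuallyEq ?_
      filter_upwards [isOpen_ne.mem_nhds hz] with w hw using hgf w hw
  have ne : ∀ x y : ℝ, y ≠ 0 → (x + y * Complex.I : ℂ) ≠ 0 := by
    intro x y hy h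
    apply hy
    simpa using congrArg Complex.im h
  have e1 : ∀ x : ℝ, f (x + y₁ * Complex.I) = g (x + y₁ * Complex.I) := fun x =>
    (hgf _ (ne x _ hy₁.ne)).symm
  have e2 : ∀ x : ℝ, f (x + y₂ * Complex.I) = g (x + y₂ * Complex.I) := fun x =>
    (hgf _ (ne x _ hy₂.ne')).symm
  simp only [e1, e2] at h1 h2 ⊢
  refine integral_line_eq_of_le (hy₁.trans hy₂).le hd' h1 h2 hd (C := C) fun x y hx hy1 hy2 => ?_
  rw [hgf]
  · exact hb x y hx hy1 hy2
  · intro h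
    have : x = 0 := by simpa using congrArg Complex.re h
    rw [this] at hx
    simp at hx
    linarith

lemma sq_norm_sinh (x y : ℝ) :
    ‖Complex.sinh (x + y * Complex.I)‖ ^ 2 = Real.sinh x ^ 2 + Real.sin y ^ 2 := by
  rw [← Complex.normSq_eq_norm_sq, Complex.sinh_add, Complex.sinh_mul_I, Complex.cosh_mul_I,
    Complex.normSq_apply]
  simp only [← Complex.ofReal_sinh, ← Complex.ofReal_cosh, ← Complex.ofReal_cos,
    ← Complex.ofReal_sin, Complex.add_re, Complex.add_im, Complex.mul_re, Complex.mul_im,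
    Complex.ofReal_re, Complex.ofReal_im, Complex.I_re, Complex.I_im]
  have h1 := Real.cosh_sq x
  have h2 := Real.sin_sq_add_cos_sq y
  have h3 : Real.cos y ^ 2 = 1 - Real.sin y ^ 2 := by linarith
  ring_nf
  rw [h1, h3]
  ring

lemma half_exp_abs_le_cosh (x : ℝ) : Real.exp |x| / 2 ≤ Real.cosh x := by
  rw [← Real.cosh_abs, Real.cosh_eq]
  linarith [Real.exp_pos (-|x|)]

lemma norm_sinh_ge_of_le {l x : ℝ} (hx : l ≤ |x|) (y : ℝ) :
    (1 - Real.exp (-(2 * l))) * (Real.exp |x| / 2) ≤ ‖Complex.sinh (x + y * Complex.I)‖ := by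
  have h1 : Real.sinh |x| ≤ ‖Complex.sinh (x + y * Complex.I)‖ := by
    refine abs_le_of_sq_le_sq' ?_ (norm_nonneg _) |>.2
    rw [sq_norm_sinh, ← Real.abs_sinh, sq_abs]
    nlinarith [sq_nonneg (Real.sin y)]
  refine le_trans ?_ h1
  rw [Real.sinh_eq]
  have : Real.exp (-|x|) ≤ Real.exp (-(2 * l)) * Real.exp |x| := by
    rw [← Real.exp_add]
    gcongr
    linarith
  linarith

lemma norm_inv_sinh_le_of_le {l x : ℝ} (hl : 0 < l) (hx : l ≤ |x|) (y : ℝ) :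
    ‖(Complex.sinh (x + y * Complex.I))⁻¹‖ ≤
      2 / (1 - Real.exp (-(2 * l))) * Real.exp (-|x|) := by
  have h := norm_sinh_ge_of_le hx y
  have h0 : 0 < 1 - Real.exp (-(2 * l)) := by
    rw [sub_pos, Real.exp_lt_one_iff]
    linarith
  rw [norm_inv]
  refine (inv_anti₀ (by positivity) h).trans_eq ?_
  rw [mul_inv, inv_div, Real.exp_neg |x|]
  ring

lemma sinh_ne_zero_of_abs_im_lt {z : ℂ} (hz : z ≠ 0) (h : |z.im| < π) : Complex.sinh z ≠ 0 := by
  intro h0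
  rw [abs_lt] at h
  have h1 := sq_norm_sinh z.re z.im
  rw [Complex.re_add_im, h0, norm_zero] at h1
  have h2 : Real.sinh z.re = 0 := by nlinarith [sq_nonneg (Real.sinh z.re), sq_nonneg (Real.sin z.im)]
  have h3 : Real.sin z.im = 0 := by nlinarith [sq_nonneg (Real.sinh z.re), sq_nonneg (Real.sin z.im)]
  rw [Real.sinh_eq_zero] at h2
  rw [Real.sin_eq_zero_iff_of_lt_of_lt h.1 h.2] at h3
  exact hz (Complex.ext h2 h3)

lemma line_ne_zero (x : ℝ) {y : ℝ} (hy : y ≠ 0) : (x + y * Complex.I : ℂ) ≠ 0 := by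
  intro h
  apply hy
  simpa using congrArg Complex.im h

/-- Exponential decay at infinity of a continuous function extends to the whole line. -/
lemma exists_decay_of_continuous {k : ℝ → ℂ} (hk : Continuous k) {C d : ℝ} (hd : 0 < d)
    (hb : ∀ x : ℝ, 1 ≤ |x| → ‖k x‖ ≤ C * Real.exp (-(d * |x|))) :
    ∃ C' : ℝ, ∀ x, ‖k x‖ ≤ C' * Real.exp (-(d * |x|)) := by
  obtain ⟨M, hM⟩ := (isCompact_Icc (a := (-1 : ℝ)) (b := 1)).exists_bound_of_continuousOn
    hk.continuousOn
  refine ⟨|C| + |M| * Real.exp d, fun x => ?_⟩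
  rcases le_total 1 |x| with hx | hx
  · refine (hb x hx).trans ?_
    gcongr
    have := le_abs_self C
    have : 0 ≤ |M| * Real.exp d := by positivity
    linarith
  · have h1 := hM x (abs_le.mp hx)
    have h2 : (1 : ℝ) ≤ Real.exp d * Real.exp (-(d * |x|)) := by
      rw [← Real.exp_add]
      apply Real.one_le_exp
      nlinarith
    have h3 : 0 ≤ |C| * Real.exp (-(d * |x|)) := by positivity
    have h4 : |M| * 1 ≤ |M| * (Real.exp d * Real.exp (-(d * |x|))) := by gcongr
    have := le_abs_self M
    calc ‖k x‖ ≤ _ := h1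
      _ ≤ _ := by linarith

lemma integrable_of_continuous_of_decay {k : ℝ → ℂ} (hk : Continuous k) {C d : ℝ} (hd : 0 < d)
    (hb : ∀ x : ℝ, 1 ≤ |x| → ‖k x‖ ≤ C * Real.exp (-(d * |x|))) : Integrable k := by
  obtain ⟨C', hC'⟩ := exists_decay_of_continuous hk hd hb
  exact (integrable_const_mul_exp_neg_mul_abs C' hd).mono' hk.aestronglyMeasurable
    (ae_of_all _ hC')

lemma hasDerivAt_arctan_sinh (x : ℝ) :
    HasDerivAt (fun x => Real.arctan (Real.sinh x)) (Real.cosh x)⁻¹ x := by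
  have := (Real.hasDerivAt_sinh x).arctan
  refine this.congr_deriv ?_
  have h1 := Real.cosh_sq x
  have h2 := Real.cosh_pos x
  rw [show 1 + Real.sinh x ^ 2 = Real.cosh x ^ 2 by linarith]
  field_simp

lemma integrable_inv_sinh_line {y : ℝ} (h0 : y ≠ 0) (h : |y| < π) :
    Integrable fun x : ℝ => (Complex.sinh (x + y * Complex.I))⁻¹ := by
  refine integrable_of_continuous_of_decay (C := 2 / (1 - Real.exp (-(2 * 1)))) (d := 1) ?_
    one_pos fun x hx => ?_
  · refine Continuous.inv₀ (by fun_prop) fun x => ?_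
    exact sinh_ne_zero_of_abs_im_lt (line_ne_zero x h0) (by simpa using h)
  · simpa using norm_inv_sinh_le_of_le one_pos hx y

lemma integral_inv_cosh : ∫ x : ℝ, ((Real.cosh x)⁻¹ : ℂ) = π := by
  have hI : Integrable fun x : ℝ => ((Real.cosh x)⁻¹ : ℂ) := by
    refine integrable_of_continuous_of_decay (C := 2) (d := 1) ?_ one_pos fun x _ => ?_
    · refine Continuous.inv₀ ?_ fun x => ?_
      · exact Complex.continuous_ofReal.comp Real.continuous_cosh
      · exact_mod_cast (Real.cosh_pos x).ne'
    · rw [norm_inv, Complex.norm_real, Real.norm_of_nonneg (Real.cosh_pos x).le, one_mul,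
        Real.exp_neg, ← div_eq_mul_inv, ← inv_div]
      exact inv_anti₀ (by positivity) (half_exp_abs_le_cosh x)
  have hI' : Integrable fun x : ℝ => (Real.cosh x)⁻¹ := by
    have := hI.re
    refine this.congr (ae_of_all _ fun x => ?_)
    simp [← Complex.ofReal_inv, -Complex.ofReal_cosh]
  have hs : Tendsto Real.sinh atTop atTop := Real.sinhOrderIso.tendsto_atTop
  have hs' : Tendsto Real.sinh atBot atBot := Real.sinhOrderIso.tendsto_atBot
  have := integral_of_hasDerivAt_of_tendsto hasDerivAt_arctan_sinh hI'
    ((Real.tendsto_arctan_atBot.mono_right nhdsWithin_le_nhds).comp hs')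
    ((Real.tendsto_arctan_atTop.mono_right nhdsWithin_le_nhds).comp hs)
  simp only [← Complex.ofReal_inv]
  rw [integral_complex_ofReal, this]
  push_cast
  ring

lemma integral_inv_sinh_of_pos {y : ℝ} (h0 : 0 < y) (h1 : y < π) :
    ∫ x : ℝ, (Complex.sinh (x + y * Complex.I))⁻¹ = -(Complex.I * π) := by
  have shift : ∀ {y₁ y₂ : ℝ}, 0 < y₁ → y₁ ≤ y₂ → y₂ < π →
      ∫ x : ℝ, (Complex.sinh (x + y₁ * Complex.I))⁻¹ =
        ∫ x : ℝ, (Complex.sinh (x + y₂ * Complex.I))⁻¹ := by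
    intro y₁ y₂ h1 h12 h2
    refine integral_line_eq_of_le (f := fun z => (Complex.sinh z)⁻¹) h12 (fun z hz1 hz2 => ?_)
      (integrable_inv_sinh_line h1.ne' (by rw [abs_of_pos] <;> linarith))
      (integrable_inv_sinh_line (by linarith) (by rw [abs_of_pos] <;> linarith))
      (C := 2 / (1 - Real.exp (-(2 * 1)))) one_pos fun x y hx _ _ => ?_
    · have : Complex.sinh z ≠ 0 := by
        refine sinh_ne_zero_of_abs_im_lt (fun h => ?_) (by rw [abs_of_pos] <;> linarith)
        simp [h] at hz1
        linarith
      exact Complex.differentiableAt_sinh.inv this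
    · simpa using norm_inv_sinh_le_of_le one_pos hx y
  have hpi := Real.pi_pos
  have base : ∫ x : ℝ, (Complex.sinh (x + (π / 2 : ℝ) * Complex.I))⁻¹ = -(Complex.I * π) := by
    have : ∀ x : ℝ, (Complex.sinh (x + (π / 2 : ℝ) * Complex.I))⁻¹ =
        (-Complex.I) * ((Real.cosh x)⁻¹ : ℂ) := by
      intro x
      rw [Complex.sinh_add, Complex.sinh_mul_I, Complex.cosh_mul_I, ← Complex.ofReal_cos,
        ← Complex.ofReal_sin, Real.cos_pi_div_two, Real.sin_pi_div_two]
      simp [mul_comm]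
    simp_rw [this]
    rw [integral_const_mul, integral_inv_cosh]
    ring
  rw [← base]
  rcases le_total y (π / 2) with h | h
  · exact shift h0 h (by linarith)
  · exact (shift (by linarith) h h1).symm

lemma integral_inv_sinh_of_neg {y : ℝ} (h0 : y < 0) (h1 : -π < y) :
    ∫ x : ℝ, (Complex.sinh (x + y * Complex.I))⁻¹ = Complex.I * π := by
  rw [← integral_neg_eq_self]
  have : ∀ x : ℝ, (Complex.sinh ((-x : ℝ) + y * Complex.I))⁻¹ =
      -(Complex.sinh (x + (-y : ℝ) * Complex.I))⁻¹ := by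
    intro x
    rw [show (((-x : ℝ) : ℂ) + y * Complex.I) = -(x + (-y : ℝ) * Complex.I) by push_cast; ring,
      Complex.sinh_neg, inv_neg]
  simp_rw [this]
  rw [integral_neg, integral_inv_sinh_of_pos (by linarith) (by linarith)]
  ring

lemma tendsto_sinh_div_self : Tendsto (fun z : ℂ => Complex.sinh z / z) (𝓝[≠] 0) (𝓝 1) := by
  have := (Complex.hasDerivAt_sinh 0).tendsto_slope_zero
  simpa [div_eq_inv_mul] using this

/-- The jump of a horizontal contour integral across a simple pole at the origin. -/
lemma integral_line_sub_of_simplePole {f : ℂ → ℂ} {y₁ y₂ : ℝ} {r : ℂ} (hy₁ : y₁ < 0)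
    (hy₁' : -π < y₁) (hy₂ : 0 < y₂) (hy₂' : y₂ < π)
    (hf : ∀ z : ℂ, z ≠ 0 → y₁ ≤ z.im → z.im ≤ y₂ → DifferentiableAt ℂ f z) (hf0 : f 0 = 0)
    (h0 : Tendsto (fun z => z * f z) (𝓝[≠] 0) (𝓝 r)) {C d : ℝ} (hd : 0 < d)
    (hb : ∀ x y : ℝ, 1 ≤ |x| → y₁ ≤ y → y ≤ y₂ →
      ‖f (x + y * Complex.I)‖ ≤ C * Real.exp (-(d * |x|))) :
    (∫ x : ℝ, f (x + y₁ * Complex.I)) - ∫ x : ℝ, f (x + y₂ * Complex.I) =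
      2 * π * Complex.I * r := by
  have hfi : ∀ y : ℝ, y ≠ 0 → y₁ ≤ y → y ≤ y₂ →
      Integrable fun x : ℝ => f (x + y * Complex.I) := by
    intro y hy h1 h2
    refine integrable_of_continuous_of_decay ?_ hd fun x hx => hb x y hx h1 h2
    refine continuous_iff_continuousAt.mpr fun x => ?_
    refine ContinuousAt.comp (f := fun x : ℝ => (x + y * Complex.I : ℂ)) ?_ (by fun_prop)
    exact (hf _ (line_ne_zero x hy) (by simpa using h1) (by simpa using h2)).continuousAt
  have i1 := hfi y₁ hy₁.ne le_rfl (hy₁.trans hy₂).le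
  have i2 := hfi y₂ hy₂.ne' (hy₁.trans hy₂).le le_rfl
  have j1 := (integrable_inv_sinh_line hy₁.ne (by rw [abs_of_neg hy₁]; linarith)).const_mul r
  have j2 := (integrable_inv_sinh_line hy₂.ne' (by rw [abs_of_pos hy₂]; linarith)).const_mul r
  have hC : ∀ x : ℝ, 1 ≤ |x| → 0 ≤ C := by
    intro x hx
    have := (norm_nonneg _).trans (hb x y₁ hx le_rfl (hy₁.trans hy₂).le)
    exact nonneg_of_mul_nonneg_left this (Real.exp_pos _)
  set S : ℝ := 2 / (1 - Real.exp (-(2 * 1)))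
  have hS : 0 ≤ S := by
    have : Real.exp (-(2 * 1)) ≤ 1 := Real.exp_le_one_iff.mpr (by norm_num)
    exact div_nonneg zero_le_two (by linarith)
  have key := integral_line_eq_of_isLittleO (f := fun z => f z - r * (Complex.sinh z)⁻¹) hy₁ hy₂
    (fun z hz h1 h2 => (hf z hz h1 h2).sub ((Complex.differentiableAt_sinh.inv
      (sinh_ne_zero_of_abs_im_lt hz (abs_lt.mpr ⟨by linarith, by linarith⟩))).const_mul r))
    (by simp [hf0]) ?_ (i1.sub j1) (i2.sub j2) (d := min d 1) (C := C + ‖r‖ * S)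
    (lt_min hd one_pos) ?_
  · rw [integral_sub i1 j1, integral_sub i2 j2, integral_const_mul, integral_const_mul,
      integral_inv_sinh_of_neg hy₁ hy₁', integral_inv_sinh_of_pos hy₂ hy₂'] at key
    linear_combination key
  · have h2 := (tendsto_sinh_div_self.inv₀ one_ne_zero).const_mul r
    have h3 := h0.sub h2
    simp only [inv_one, mul_one, sub_self] at h3
    refine h3.congr fun z => ?_
    rw [inv_div]
    ring
  · intro x y hx h1 h2
    refine (norm_sub_le _ _).trans ?_
    have e1 : Real.exp (-(d * |x|)) ≤ Real.exp (-(min d 1 * |x|)) := by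
      gcongr; exact min_le_left _ _
    have e2 : Real.exp (-|x|) ≤ Real.exp (-(min d 1 * |x|)) := by
      gcongr
      nlinarith [min_le_right d 1]
    rw [norm_mul, add_mul]
    refine add_le_add ((hb x y hx h1 h2).trans ?_) ?_
    · exact mul_le_mul_of_nonneg_left e1 (hC x hx)
    · rw [mul_assoc]
      refine mul_le_mul_of_nonneg_left ?_ (norm_nonneg _)
      exact (norm_inv_sinh_le_of_le one_pos hx y).trans (mul_le_mul_of_nonneg_left e2 hS)

/-- The Fourier integral of `1 / sinh` along a line in the upper half plane. -/
lemma integral_exp_div_sinh {ζ : ℂ} (hζ : |ζ.im| < 1 / 2) {y : ℝ} (hy : 0 < y) (hy' : y < π) :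
    (∫ x : ℝ, Complex.exp (-2 * Complex.I * ζ * (x + y * Complex.I)) *
      (Complex.sinh (x + y * Complex.I))⁻¹) * (1 + Complex.exp (-(2 * π * ζ))) =
      -(2 * π * Complex.I) := by
  set f : ℂ → ℂ := fun z => Complex.exp (-2 * Complex.I * ζ * z) * (Complex.sinh z)⁻¹ with hf
  set S : ℝ := 2 / (1 - Real.exp (-(2 * 1)))
  have hS : 0 ≤ S := by
    have : Real.exp (-(2 * 1)) ≤ 1 := Real.exp_le_one_iff.mpr (by norm_num)
    exact div_nonneg zero_le_two (by linarith)
  have key := integral_line_sub_of_simplePole (f := f) (y₁ := y - π) (y₂ := y) (r := 1)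
    (by linarith) (by linarith) hy hy' (fun z hz h1 h2 => by
      refine DifferentiableAt.mul (by fun_prop) (Complex.differentiableAt_sinh.inv ?_)
      exact sinh_ne_zero_of_abs_im_lt hz (abs_lt.mpr ⟨by linarith, by linarith⟩))
    (by simp [hf]) ?_ (d := 1 - 2 * |ζ.im|) (C := Real.exp (2 * |ζ.re| * π) * S) (by linarith) ?_
  · have : ∀ x : ℝ, f (x + (y - π : ℝ) * Complex.I) =
        -Complex.exp (-(2 * π * ζ)) * f (x + y * Complex.I) := by
      intro x
      have e1 : (x + (y - π : ℝ) * Complex.I : ℂ) = x + y * Complex.I - π * Complex.I := by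
        push_cast; ring
      have e2 : -2 * Complex.I * ζ * (x + y * Complex.I - π * Complex.I) =
          -2 * Complex.I * ζ * (x + y * Complex.I) + -(2 * π * ζ) := by
        linear_combination (2 * ζ * π) * Complex.I_mul_I
      simp only [hf]
      rw [e1, e2, Complex.sinh_sub, Complex.sinh_mul_I, Complex.cosh_mul_I, Complex.cos_pi,
        Complex.sin_pi, Complex.exp_add]
      simp only [zero_mul, mul_zero, sub_zero, mul_neg, mul_one, inv_neg]
      ring
    simp_rw [this] at key
    rw [integral_const_mul] at key
    linear_combination -key
  · have h1 : Tendsto (fun z : ℂ => Complex.exp (-2 * Complex.I * ζ * z)) (𝓝[≠] 0) (𝓝 1) := by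
      have : ContinuousAt (fun z : ℂ => Complex.exp (-2 * Complex.I * ζ * z)) 0 := by fun_prop
      simpa [ContinuousAt] using this.tendsto.mono_left nhdsWithin_le_nhds
    have h2 := h1.mul (tendsto_sinh_div_self.inv₀ one_ne_zero)
    simp only [inv_one, mul_one] at h2
    refine h2.congr fun z => ?_
    simp only [hf]
    rw [inv_div]
    ring
  · intro x v hx h1 h2
    simp only [hf, norm_mul]
    have e1 : ‖Complex.exp (-2 * Complex.I * ζ * (x + v * Complex.I))‖ ≤
        Real.exp (2 * |ζ.re| * π) * Real.exp (2 * |ζ.im| * |x|) := by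
      rw [Complex.norm_exp, ← Real.exp_add]
      gcongr
      have : (-2 * Complex.I * ζ * (x + v * Complex.I)).re = 2 * (ζ.re * v) + 2 * (ζ.im * x) := by
        simp; ring
      rw [this]
      have hv : |v| ≤ π := abs_le.mpr ⟨by linarith, by linarith⟩
      have a1 : ζ.re * v ≤ |ζ.re| * π := (le_abs_self _).trans (by rw [abs_mul]; gcongr)
      have a2 : ζ.im * x ≤ |ζ.im| * |x| := (le_abs_self _).trans (by rw [abs_mul])
      linarith
    calc _ ≤ (Real.exp (2 * |ζ.re| * π) * Real.exp (2 * |ζ.im| * |x|)) *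
          (S * Real.exp (-|x|)) := by
          gcongr
          exact norm_inv_sinh_le_of_le one_pos hx v
      _ = Real.exp (2 * |ζ.re| * π) * S * (Real.exp (2 * |ζ.im| * |x|) * Real.exp (-|x|)) := by
        ring
      _ = _ := by rw [← Real.exp_add]; ring_nf

/-- The logarithm kernel `1 / (4 sinh(𝖻w) sinh(w/𝖻) w)`. -/
def dilogKer (b : ℝ) (w : ℂ) : ℂ := (4 * Complex.sinh (w * b) * Complex.sinh (w / b) * w)⁻¹

/-- The height of the integration contour in the definition of `PhiS`. -/
def ctrHeight (b : ℝ) : ℝ := π * min b b⁻¹ / 2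

/-- The logarithm of `PhiS`. -/
def dilogLog (b : ℝ) (z : ℂ) : ℂ :=
  lineLaplace (fun x => dilogKer b (x + ctrHeight b * Complex.I)) (ctrHeight b)
    (-2 * Complex.I * z)

lemma PhiS_eq_exp_dilogLog (b : ℝ) (z : ℂ) : PhiS b z = Complex.exp (dilogLog b z) := by
  unfold PhiS dilogLog lineLaplace phiKer dilogKer ctrHeight
  congr 2
  ext t
  rw [div_eq_mul_inv, mul_comm]
  push_cast
  ring_nf

lemma ctrHeight_pos {b : ℝ} (hb : 0 < b) : 0 < ctrHeight b := by
  unfold ctrHeight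
  have : 0 < min b b⁻¹ := lt_min hb (inv_pos.mpr hb)
  positivity

lemma ctrHeight_mul_le {b : ℝ} (hb : 0 < b) : ctrHeight b * b ≤ π / 2 := by
  unfold ctrHeight
  have : min b b⁻¹ * b ≤ 1 := by
    calc min b b⁻¹ * b ≤ b⁻¹ * b := by gcongr; exact min_le_right _ _
      _ = 1 := inv_mul_cancel₀ hb.ne'
  nlinarith [Real.pi_pos]

lemma ctrHeight_inv (b : ℝ) : ctrHeight b⁻¹ = ctrHeight b := by
  unfold ctrHeight
  rw [inv_inv, min_comm]

lemma ctrHeight_div_le {b : ℝ} (hb : 0 < b) : ctrHeight b / b ≤ π / 2 := by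
  have := ctrHeight_mul_le (inv_pos.mpr hb)
  rwa [ctrHeight_inv, ← div_eq_mul_inv] at this

lemma ctrHeight_lt_pi {b : ℝ} (hb : 0 < b) : ctrHeight b < π := by
  have h1 := ctrHeight_mul_le hb
  have h2 := ctrHeight_div_le hb
  have h0 := ctrHeight_pos hb
  rw [div_le_iff₀ hb] at h2
  have := Real.pi_pos
  rcases le_total b 1 with h | h <;> nlinarith

lemma dilogKer_inv (b : ℝ) (w : ℂ) : dilogKer b⁻¹ w = dilogKer b w := by
  unfold dilogKer
  push_cast
  rw [div_inv_eq_mul, ← div_eq_mul_inv]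
  ring_nf

lemma dilogLog_inv (b : ℝ) (z : ℂ) : dilogLog b⁻¹ z = dilogLog b z := by
  unfold dilogLog
  simp only [dilogKer_inv, ctrHeight_inv]

lemma dilogKer_neg (b : ℝ) (w : ℂ) : dilogKer b (-w) = -dilogKer b w := by
  unfold dilogKer
  rw [neg_mul, neg_div, Complex.sinh_neg, Complex.sinh_neg, ← inv_neg]
  ring_nf

lemma sinh_mul_ne_zero {w : ℂ} {l : ℝ} (hl : l ≠ 0) (hw : w ≠ 0) (h : |w.im * l| < π) :
    Complex.sinh (w * l) ≠ 0 :=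
  sinh_ne_zero_of_abs_im_lt (mul_ne_zero hw (by exact_mod_cast hl)) (by simpa using h)

lemma abs_im_mul_lt_pi {b y : ℝ} (hb : 0 < b) (hy : |y| ≤ ctrHeight b) : |y * b| < π := by
  rw [abs_mul, abs_of_pos hb]
  have := ctrHeight_mul_le hb
  have := Real.pi_pos
  nlinarith

lemma abs_im_mul_inv_lt_pi {b y : ℝ} (hb : 0 < b) (hy : |y| ≤ ctrHeight b) : |y * b⁻¹| < π :=
  abs_im_mul_lt_pi (inv_pos.mpr hb) (by rwa [ctrHeight_inv])

lemma differentiableAt_dilogKer {b : ℝ} (hb : 0 < b) {w : ℂ} (hw : w ≠ 0)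
    (h : |w.im| ≤ ctrHeight b) : DifferentiableAt ℂ (dilogKer b) w := by
  unfold dilogKer
  have h1 := sinh_mul_ne_zero hb.ne' hw (abs_im_mul_lt_pi hb h)
  have h2 := sinh_mul_ne_zero (inv_pos.mpr hb).ne' hw (abs_im_mul_inv_lt_pi hb h)
  push_cast at h2
  rw [← div_eq_mul_inv] at h2
  refine DifferentiableAt.inv (by fun_prop) ?_
  exact mul_ne_zero (mul_ne_zero (mul_ne_zero (by norm_num) h1) h2) hw

lemma norm_inv_sinh_mul_le {l : ℝ} (hl : 0 < l) {x : ℝ} (hx : 1 ≤ |x|) (y : ℝ) :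
    ‖(Complex.sinh ((x + y * Complex.I) * l))⁻¹‖ ≤
      2 / (1 - Real.exp (-(2 * l))) * Real.exp (-(l * |x|)) := by
  have := norm_inv_sinh_le_of_le (x := x * l) hl
    (by rw [abs_mul, abs_of_pos hl]; nlinarith) (y * l)
  rw [abs_mul, abs_of_pos hl, mul_comm |x|] at this
  convert this using 4
  push_cast
  ring

lemma norm_inv_line_le {x : ℝ} (hx : 1 ≤ |x|) (y : ℝ) : ‖(x + y * Complex.I : ℂ)⁻¹‖ ≤ 1 := by
  rw [norm_inv]
  refine inv_le_one_of_one_le₀ (hx.trans ?_)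
  simpa using Complex.abs_re_le_norm (x + y * Complex.I : ℂ)

lemma exists_norm_dilogKer_le {b : ℝ} (hb : 0 < b) : ∃ C : ℝ, ∀ x y : ℝ, 1 ≤ |x| →
    ‖dilogKer b (x + y * Complex.I)‖ ≤ C * Real.exp (-((b + b⁻¹) * |x|)) := by
  have hb' := inv_pos.mpr hb
  set S := 2 / (1 - Real.exp (-(2 * b)))
  set S' := 2 / (1 - Real.exp (-(2 * b⁻¹)))
  refine ⟨4⁻¹ * S * S', fun x y hx => ?_⟩
  have h1 := norm_inv_sinh_mul_le hb hx y
  have h2 := norm_inv_sinh_mul_le hb' hx y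
  have h3 := norm_inv_line_le hx y
  unfold dilogKer
  rw [mul_inv, mul_inv, mul_inv, norm_mul, norm_mul, norm_mul]
  rw [Complex.ofReal_inv, ← div_eq_mul_inv] at h2
  have h4 : ‖(4 : ℂ)⁻¹‖ = 4⁻¹ := by simp
  rw [h4]
  calc _ ≤ 4⁻¹ * (S * Real.exp (-(b * |x|))) * (S' * Real.exp (-(b⁻¹ * |x|))) * 1 := by
        have h5 := (norm_nonneg _).trans h1
        have h6 := (norm_nonneg _).trans h2
        gcongr
    _ = 4⁻¹ * S * S' * (Real.exp (-(b * |x|)) * Real.exp (-(b⁻¹ * |x|))) := by ring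
    _ = _ := by rw [← Real.exp_add]; ring_nf

lemma continuous_line_of_differentiableAt {f : ℂ → ℂ} {y : ℝ}
    (hf : ∀ x : ℝ, DifferentiableAt ℂ f (x + y * Complex.I)) :
    Continuous fun x : ℝ => f (x + y * Complex.I) :=
  continuous_iff_continuousAt.mpr fun x =>
    ContinuousAt.comp (f := fun x : ℝ => (x + y * Complex.I : ℂ)) (hf x).continuousAt
      (by fun_prop)

lemma continuous_dilogKer_line {b : ℝ} (hb : 0 < b) :
    Continuous fun x : ℝ => dilogKer b (x + ctrHeight b * Complex.I) :=
  continuous_line_of_differentiableAt fun x =>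
    differentiableAt_dilogKer hb (line_ne_zero x (ctrHeight_pos hb).ne')
      (by simp [abs_of_pos (ctrHeight_pos hb)])

lemma two_sided_of_decay {k : ℝ → ℂ} {C d : ℝ} (h : ∀ x, ‖k x‖ ≤ C * Real.exp (-(d * |x|)))
    {p : ℝ} (hp : |p| ≤ d) (x : ℝ) : ‖k x‖ ≤ C * Real.exp (-(p * x)) := by
  have hC : 0 ≤ C := by simpa using (norm_nonneg _).trans (h 0)
  refine (h x).trans (mul_le_mul_of_nonneg_left (Real.exp_le_exp.mpr (neg_le_neg ?_)) hC)
  calc p * x ≤ |p| * |x| := (le_abs_self _).trans (abs_mul _ _).le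
    _ ≤ d * |x| := by gcongr

lemma exists_dilogKer_line_bound {b : ℝ} (hb : 0 < b) : ∃ C : ℝ,
    ∀ x : ℝ, ‖dilogKer b (x + ctrHeight b * Complex.I)‖ ≤
      C * Real.exp (-((b + b⁻¹) * |x|)) := by
  obtain ⟨C, hC⟩ := exists_norm_dilogKer_le hb
  exact exists_decay_of_continuous (continuous_dilogKer_line hb)
    (add_pos hb (inv_pos.mpr hb)) fun x hx => hC x _ hx

lemma integrable_dilogLog {b : ℝ} (hb : 0 < b) {z : ℂ} (hz : |z.im| < (b + b⁻¹) / 2) :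
    Integrable fun x : ℝ => dilogKer b (x + ctrHeight b * Complex.I) *
      Complex.exp (-2 * Complex.I * z * (x + ctrHeight b * Complex.I)) := by
  obtain ⟨C, hC⟩ := exists_dilogKer_line_bound hb
  have hd : 0 < b + b⁻¹ := add_pos hb (inv_pos.mpr hb)
  rw [abs_lt] at hz
  refine integrable_lineLaplace (continuous_dilogKer_line hb)
    (two_sided_of_decay hC (p := -(b + b⁻¹)) (by rw [abs_neg, abs_of_pos hd]))
    (two_sided_of_decay hC (p := b + b⁻¹) (by rw [abs_of_pos hd])) _ ?_ ?_ <;> simp <;> linarith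

lemma differentiableAt_dilogLog {b : ℝ} (hb : 0 < b) {z : ℂ} (hz : |z.im| < (b + b⁻¹) / 2) :
    DifferentiableAt ℂ (dilogLog b) z := by
  obtain ⟨C, hC⟩ := exists_dilogKer_line_bound hb
  have hd : 0 < b + b⁻¹ := add_pos hb (inv_pos.mpr hb)
  rw [abs_lt] at hz
  unfold dilogLog
  refine DifferentiableAt.comp (g := lineLaplace _ _) z
    (hasDerivAt_lineLaplace (continuous_dilogKer_line hb)
      (two_sided_of_decay hC (p := -(b + b⁻¹)) (by rw [abs_neg, abs_of_pos hd]))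
      (two_sided_of_decay hC (p := b + b⁻¹) (by rw [abs_of_pos hd])) _ ?_ ?_).differentiableAt
    (by fun_prop) <;> simp <;> linarith

/-- On closed substrips, `dilogLog` decays exponentially to the left. -/
lemma exists_norm_dilogLog_le {b : ℝ} (hb : 0 < b) {Y : ℝ} (hY : Y < (b + b⁻¹) / 2) :
    ∃ C : ℝ, ∀ z : ℂ, |z.im| ≤ Y → ‖dilogLog b z‖ ≤ C * Real.exp (2 * ctrHeight b * z.re) := by
  obtain ⟨C, hC⟩ := exists_dilogKer_line_bound hb
  have hd : 0 < b + b⁻¹ := add_pos hb (inv_pos.mpr hb)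
  refine ⟨∫ x : ℝ, C * Real.exp (-((b + b⁻¹ - 2 * Y) * |x|)), fun z hz => ?_⟩
  rw [abs_le] at hz
  refine (norm_lineLaplace_le
    (two_sided_of_decay hC (p := -(b + b⁻¹)) (by rw [abs_neg, abs_of_pos hd]))
    (two_sided_of_decay hC (p := b + b⁻¹) (by rw [abs_of_pos hd])) _
    (d := (b + b⁻¹) - 2 * Y) (by linarith) ?_ ?_).trans_eq ?_
  · simp; linarith
  · simp; linarith
  · congr 2
    simp
    ring

lemma conj_dilogLog (b : ℝ) (z : ℂ) :
    (starRingEnd ℂ) (dilogLog b z) = -dilogLog b ((starRingEnd ℂ) z) := by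
  have hker : ∀ w, (starRingEnd ℂ) (dilogKer b w) = dilogKer b ((starRingEnd ℂ) w) := by
    intro w
    unfold dilogKer
    rw [map_inv₀, map_mul, map_mul, map_mul, ← Complex.sinh_conj, ← Complex.sinh_conj, map_mul,
      map_div₀, Complex.conj_ofReal, Complex.conj_ofNat]
  unfold dilogLog lineLaplace
  rw [← integral_conj, ← integral_neg_eq_self, ← integral_neg]
  congr 1
  ext x
  have e : (starRingEnd ℂ) (((-x : ℝ) : ℂ) + ctrHeight b * Complex.I) =
      -(x + ctrHeight b * Complex.I) := by
    simp only [map_add, map_mul, Complex.conj_ofReal, Complex.conj_I]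
    push_cast
    ring
  rw [map_mul, hker, ← Complex.exp_conj, map_mul, e, dilogKer_neg]
  simp only [map_mul, map_neg, Complex.conj_I, Complex.conj_ofNat, neg_mul, mul_neg, neg_neg]

/-- The kernel of the difference `dilogLog (z - i𝖻/2) - dilogLog (z + i𝖻/2)`. -/
def shiftKer (b : ℝ) (w : ℂ) : ℂ := -(2 : ℂ)⁻¹ * ((Complex.sinh (w * (b⁻¹ : ℝ)))⁻¹ * w⁻¹)

lemma dilogKer_mul_exp_sub {b : ℝ} (hb : 0 < b) {w : ℂ} (hw : w ≠ 0) (h : |w.im| ≤ ctrHeight b)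
    (z : ℂ) :
    dilogKer b w * Complex.exp (-2 * Complex.I * (z - Complex.I * b / 2) * w) -
      dilogKer b w * Complex.exp (-2 * Complex.I * (z + Complex.I * b / 2) * w) =
      shiftKer b w * Complex.exp (-2 * Complex.I * z * w) := by
  have h1 := sinh_mul_ne_zero hb.ne' hw (abs_im_mul_lt_pi hb h)
  have e1 : -2 * Complex.I * (z - Complex.I * b / 2) * w = -2 * Complex.I * z * w + -(w * b) := by
    linear_combination (b * w) * Complex.I_mul_I
  have e2 : -2 * Complex.I * (z + Complex.I * b / 2) * w = -2 * Complex.I * z * w + w * b := by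
    linear_combination -(b * w) * Complex.I_mul_I
  have e3 : Complex.exp (-(w * b)) - Complex.exp (w * b) = -2 * Complex.sinh (w * b) := by
    unfold Complex.sinh
    ring
  rw [e1, e2, Complex.exp_add, Complex.exp_add, ← mul_sub, ← mul_sub, e3]
  unfold dilogKer shiftKer
  push_cast
  rw [← div_eq_mul_inv w (b : ℂ), mul_inv, mul_inv, mul_inv]
  field_simp
  norm_num

lemma continuous_shiftKer_line {b : ℝ} (hb : 0 < b) :
    Continuous fun x : ℝ => shiftKer b (x + ctrHeight b * Complex.I) := by
  unfold shiftKer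
  refine continuous_const.mul (Continuous.mul ?_ ?_)
  · refine Continuous.inv₀ (by fun_prop) fun x => sinh_mul_ne_zero (inv_pos.mpr hb).ne'
      (line_ne_zero x (ctrHeight_pos hb).ne') (abs_im_mul_inv_lt_pi hb ?_)
    simp [abs_of_pos (ctrHeight_pos hb)]
  · exact Continuous.inv₀ (by fun_prop) fun x => line_ne_zero x (ctrHeight_pos hb).ne'

lemma exists_shiftKer_line_bound {b : ℝ} (hb : 0 < b) : ∃ C : ℝ,
    ∀ x : ℝ, ‖shiftKer b (x + ctrHeight b * Complex.I)‖ ≤ C * Real.exp (-(b⁻¹ * |x|)) := by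
  refine exists_decay_of_continuous (C := 2 / (1 - Real.exp (-(2 * b⁻¹))))
    (continuous_shiftKer_line hb) (inv_pos.mpr hb) fun x hx => ?_
  have h1 := norm_inv_sinh_mul_le (inv_pos.mpr hb) hx (ctrHeight b)
  have h2 := norm_inv_line_le hx (ctrHeight b)
  have h3 := (norm_nonneg _).trans h1
  unfold shiftKer
  rw [norm_mul, norm_mul]
  calc _ ≤ 1 * ((2 / (1 - Real.exp (-(2 * b⁻¹))) * Real.exp (-(b⁻¹ * |x|))) * 1) := by
        gcongr
        norm_num
    _ = _ := by ring

/-- The difference `dilogLog (z - i𝖻/2) - dilogLog (z + i𝖻/2)` as a single integral. -/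
def shiftLog (b : ℝ) (z : ℂ) : ℂ :=
  lineLaplace (fun x => shiftKer b (x + ctrHeight b * Complex.I)) (ctrHeight b)
    (-2 * Complex.I * z)

lemma dilogLog_sub {b : ℝ} (hb : 0 < b) {z : ℂ} (hz : |z.im| < b⁻¹ / 2) :
    dilogLog b (z - Complex.I * b / 2) - dilogLog b (z + Complex.I * b / 2) = shiftLog b z := by
  unfold dilogLog shiftLog lineLaplace
  rw [abs_lt] at hz
  rw [← integral_sub]
  · congr 1
    ext x
    exact dilogKer_mul_exp_sub hb (line_ne_zero x (ctrHeight_pos hb).ne')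
      (by simp [abs_of_pos (ctrHeight_pos hb)]) z
  · refine integrable_dilogLog hb (abs_lt.mpr ?_)
    simp
    constructor <;> linarith
  · refine integrable_dilogLog hb (abs_lt.mpr ?_)
    simp
    constructor <;> linarith

lemma hasDerivAt_shiftLog {b : ℝ} (hb : 0 < b) {z : ℂ} (hz : |z.im| < b⁻¹ / 2) :
    ∃ D : ℂ, HasDerivAt (shiftLog b) D z ∧ D * (1 + Complex.exp (-(2 * π * (b * z)))) =
      2 * π * b := by
  obtain ⟨C, hC⟩ := exists_shiftKer_line_bound hb
  have hd : 0 < b⁻¹ := inv_pos.mpr hb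
  have hbC : (b : ℂ) ≠ 0 := by exact_mod_cast hb.ne'
  set ε := ctrHeight b with hε
  have hε0 : 0 < ε := ctrHeight_pos hb
  have key : HasDerivAt (shiftLog b) _ z := HasDerivAt.comp (h₂ := lineLaplace _ _) z
    (hasDerivAt_lineLaplace (continuous_shiftKer_line hb)
      (two_sided_of_decay hC (p := -b⁻¹) (by rw [abs_neg, abs_of_pos hd]))
      (two_sided_of_decay hC (p := b⁻¹) (by rw [abs_of_pos hd])) _
      (s := -2 * Complex.I * z)
      (by rw [abs_lt] at hz; simp; linarith) (by rw [abs_lt] at hz; simp; linarith))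
    ((hasDerivAt_id z).const_mul (-2 * Complex.I))
  refine ⟨_, key, ?_⟩
  have e1 : (∫ x : ℝ, (x + ε * Complex.I) * (shiftKer b (x + ε * Complex.I) *
      Complex.exp (-2 * Complex.I * z * (x + ε * Complex.I)))) =
      -(2 : ℂ)⁻¹ * (b * ∫ t : ℝ, Complex.exp (-2 * Complex.I * (b * z) *
        (t + (ε / b : ℝ) * Complex.I)) * (Complex.sinh (t + (ε / b : ℝ) * Complex.I))⁻¹) := by
    have := Measure.integral_comp_mul_left (fun x : ℝ => (x + ε * Complex.I) *
      (shiftKer b (x + ε * Complex.I) *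
      Complex.exp (-2 * Complex.I * z * (x + ε * Complex.I)))) b
    rw [abs_of_pos hd] at this
    rw [mul_left_comm (-(2 : ℂ)⁻¹) (b : ℂ), ← integral_const_mul (-(2 : ℂ)⁻¹)]
    have h2 : (∫ x : ℝ, (x + ε * Complex.I) * (shiftKer b (x + ε * Complex.I) *
      Complex.exp (-2 * Complex.I * z * (x + ε * Complex.I)))) =
      b * (b⁻¹ • ∫ x : ℝ, (x + ε * Complex.I) * (shiftKer b (x + ε * Complex.I) *
      Complex.exp (-2 * Complex.I * z * (x + ε * Complex.I)))) := by
      rw [Complex.real_smul]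
      push_cast
      rw [mul_inv_cancel_left₀ hbC]
    rw [h2, ← this]
    congr 2
    ext t
    have hne : ((b * t : ℝ) + ε * Complex.I : ℂ) ≠ 0 := line_ne_zero _ hε0.ne'
    have e2 : ((b * t : ℝ) + ε * Complex.I : ℂ) = b * (t + (ε / b : ℝ) * Complex.I) := by
      push_cast
      field_simp
    unfold shiftKer
    rw [show ∀ (A E : ℂ), ((b * t : ℝ) + ε * Complex.I : ℂ) * (-(2 : ℂ)⁻¹ * (A *
      ((b * t : ℝ) + ε * Complex.I : ℂ)⁻¹) * E) = -(2 : ℂ)⁻¹ * (E * A) by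
        intro A E
        field_simp]
    rw [e2]
    congr 3
    · ring_nf
    · congr 1
      push_cast
      field_simp
  have e3 := integral_exp_div_sinh (ζ := b * z) (y := ε / b) (by
    simp only [Complex.mul_im, Complex.ofReal_re, Complex.ofReal_im, zero_mul, add_zero, abs_mul,
      abs_of_pos hb]
    calc b * |z.im| < b * (b⁻¹ / 2) := by gcongr
      _ = 1 / 2 := by field_simp) (by positivity)
    (by have := ctrHeight_div_le hb; have := Real.pi_pos; linarith)
  rw [e1]
  linear_combination (Complex.I * b) * e3 - 2 * π * b * Complex.I_mul_I

lemma exists_norm_shiftLog_le {b : ℝ} (hb : 0 < b) {Y : ℝ} (hY : Y < b⁻¹ / 2) :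
    ∃ C : ℝ, ∀ z : ℂ, |z.im| ≤ Y → ‖shiftLog b z‖ ≤ C * Real.exp (2 * ctrHeight b * z.re) := by
  obtain ⟨C, hC⟩ := exists_shiftKer_line_bound hb
  have hd : 0 < b⁻¹ := inv_pos.mpr hb
  refine ⟨∫ x : ℝ, C * Real.exp (-((b⁻¹ - 2 * Y) * |x|)), fun z hz => ?_⟩
  rw [abs_le] at hz
  refine (norm_lineLaplace_le
    (two_sided_of_decay hC (p := -b⁻¹) (by rw [abs_neg, abs_of_pos hd]))
    (two_sided_of_decay hC (p := b⁻¹) (by rw [abs_of_pos hd])) _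
    (d := b⁻¹ - 2 * Y) (by linarith) ?_ ?_).trans_eq ?_
  · simp; linarith
  · simp; linarith
  · congr 2
    simp
    ring

lemma exp_neg_shiftLog_mul {b : ℝ} (hb : 0 < b) {z : ℂ} (hz : |z.im| < b⁻¹ / 2) :
    Complex.exp (-shiftLog b z) * (1 + Complex.exp (2 * π * (b * z))) = 1 := by
  set v := z.im with hv
  set F : ℝ → ℂ := fun x => Complex.exp (-shiftLog b (x + v * Complex.I)) *
    (1 + Complex.exp (2 * π * (b * (x + v * Complex.I)))) with hF
  have hderiv : ∀ x, HasDerivAt F 0 x := by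
    intro x
    obtain ⟨D, hD, hD'⟩ := hasDerivAt_shiftLog hb (z := x + v * Complex.I) (by simpa using hz)
    have hl : HasDerivAt (fun x : ℝ => (x + v * Complex.I : ℂ)) 1 x :=
      (Complex.ofRealCLM.hasDerivAt (x := x)).add_const _
    have h1 := hD.comp x hl
    have h2 := ((hl.const_mul (b : ℂ)).const_mul (2 * π : ℂ)).cexp.const_add 1
    refine (h1.neg.cexp.mul h2).congr_deriv ?_
    rw [Complex.exp_neg] at hD'
    have hne := Complex.exp_ne_zero (2 * π * (b * (x + v * Complex.I)))
    have hD2 : D * (1 + Complex.exp (2 * π * (b * (x + v * Complex.I)))) =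
        2 * π * b * Complex.exp (2 * π * (b * (x + v * Complex.I))) := by
      rw [← hD']
      field_simp
      ring
    simp only [Function.comp_def, Pi.neg_apply, mul_one]
    linear_combination -Complex.exp (-shiftLog b (x + v * Complex.I)) * hD2
  have hconst : ∀ x y, F x = F y :=
    is_const_of_deriv_eq_zero (fun x => (hderiv x).differentiableAt) fun x => (hderiv x).deriv
  have hε := ctrHeight_pos hb
  obtain ⟨C, hC⟩ := exists_norm_shiftLog_le hb hz
  have hlim : Tendsto F atBot (𝓝 (Complex.exp (-0) * (1 + 0))) := by
    refine Tendsto.mul ?_ (tendsto_const_nhds.add ?_)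
    · refine (Complex.continuous_exp.tendsto _).comp (Tendsto.neg ?_)
      have : Tendsto (fun x : ℝ => C * Real.exp (2 * ctrHeight b * x)) atBot (𝓝 0) := by
        have := (Real.tendsto_exp_atBot.comp
          (tendsto_id.const_mul_atBot (by positivity : 0 < 2 * ctrHeight b))).const_mul C
        simpa using this
      refine squeeze_zero_norm (fun x => ?_) this
      simpa using hC (x + v * Complex.I) (by simp)
    · have : Tendsto (fun x : ℝ => Real.exp (2 * π * b * x)) atBot (𝓝 0) :=
        Real.tendsto_exp_atBot.comp (tendsto_id.const_mul_atBot (by positivity))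
      refine squeeze_zero_norm (fun x => ?_) this
      rw [Complex.norm_exp]
      apply le_of_eq
      congr 1
      simp
      ring
  have h1 : F z.re = 1 := by
    have : Tendsto F atBot (𝓝 (F z.re)) := tendsto_const_nhds.congr fun x => hconst z.re x
    have := tendsto_nhds_unique this hlim
    simpa using this
  simpa [hF, hv, Complex.re_add_im] using h1

/-- The reciprocal of the quantum dilogarithm on the strip. -/
def dilogInv (b : ℝ) (z : ℂ) : ℂ := Complex.exp (-dilogLog b z)

lemma dilogInv_ne_zero (b : ℝ) (z : ℂ) : dilogInv b z ≠ 0 := Complex.exp_ne_zero _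

lemma dilogInv_inv (b : ℝ) (z : ℂ) : dilogInv b⁻¹ z = dilogInv b z := by
  unfold dilogInv; rw [dilogLog_inv]

/-- The functional equation of the quantum dilogarithm. -/
lemma dilogInv_shift {b : ℝ} (hb : 0 < b) {z : ℂ} (hz : |z.im| < b⁻¹ / 2) :
    dilogInv b (z + Complex.I * b / 2) =
      (1 + Complex.exp (2 * π * (b * z))) * dilogInv b (z - Complex.I * b / 2) := by
  have h := exp_neg_shiftLog_mul hb hz
  rw [← dilogLog_sub hb hz] at h
  unfold dilogInv
  have e : Complex.exp (-dilogLog b (z - Complex.I * b / 2)) =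
      Complex.exp (-(dilogLog b (z - Complex.I * b / 2) - dilogLog b (z + Complex.I * b / 2))) *
        Complex.exp (-dilogLog b (z + Complex.I * b / 2)) := by
    rw [← Complex.exp_add]; ring_nf
  rw [e]
  linear_combination -Complex.exp (-dilogLog b (z + Complex.I * b / 2)) * h

/-- `F w = 1 + α w² + o(w²)` as `w → 0`, `w ≠ 0`. -/
def HasSecondOrder (F : ℂ → ℂ) (α : ℂ) : Prop :=
  Tendsto (fun w => (F w - 1) / w ^ 2) (𝓝[≠] 0) (𝓝 α)

namespace HasSecondOrder

variable {F G : ℂ → ℂ} {α β : ℂ}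

lemma tendsto_one (hF : HasSecondOrder F α) : Tendsto F (𝓝[≠] 0) (𝓝 1) := by
  have h1 : Tendsto (fun w : ℂ => w ^ 2) (𝓝[≠] 0) (𝓝 0) := by
    have : ContinuousAt (fun w : ℂ => w ^ 2) 0 := by fun_prop
    simpa [ContinuousAt] using this.tendsto.mono_left nhdsWithin_le_nhds
  have h2 := (hF.mul h1).add_const 1
  simp only [mul_zero, zero_add] at h2
  refine h2.congr' ?_
  filter_upwards [self_mem_nhdsWithin] with w hw
  have hw : w ≠ 0 := hw
  field_simp
  ring

lemma mul (hF : HasSecondOrder F α) (hG : HasSecondOrder G β) :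
    HasSecondOrder (fun w => F w * G w) (α + β) := by
  have h := (Tendsto.mul hF hG.tendsto_one).add hG
  rw [mul_one] at h
  refine h.congr fun w => ?_
  ring

lemma inv (hF : HasSecondOrder F α) : HasSecondOrder (fun w => (F w)⁻¹) (-α) := by
  have h := (Tendsto.neg hF).mul (hF.tendsto_one.inv₀ one_ne_zero)
  rw [inv_one, mul_one] at h
  refine h.congr' ?_
  filter_upwards [hF.tendsto_one.eventually_ne one_ne_zero] with w hw
  field_simp
  ring

lemma comp_mul_right (hF : HasSecondOrder F α) {c : ℂ} (hc : c ≠ 0) :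
    HasSecondOrder (fun w => F (w * c)) (c ^ 2 * α) := by
  have h1 : Tendsto (fun w : ℂ => w * c) (𝓝[≠] 0) (𝓝[≠] 0) := by
    refine tendsto_nhdsWithin_iff.mpr ⟨?_, ?_⟩
    · have : ContinuousAt (fun w : ℂ => w * c) 0 := by fun_prop
      simpa [ContinuousAt] using this.tendsto.mono_left nhdsWithin_le_nhds
    · filter_upwards [self_mem_nhdsWithin] with w hw using mul_ne_zero hw hc
  have h2 := (Tendsto.comp hF h1).const_mul (c ^ 2)
  refine h2.congr fun w => ?_
  simp only [Function.comp_apply]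
  rw [mul_pow]
  field_simp

end HasSecondOrder

lemma hasSecondOrder_cosh (c : ℂ) : HasSecondOrder (fun w => Complex.cosh (w * c)) (c ^ 2 / 2) := by
  have h1 : HasDerivAt (fun w : ℂ => Complex.sinh (w * (c / 2))) (c / 2) 0 := by
    have := ((hasDerivAt_id (0 : ℂ)).mul_const (c / 2)).csinh
    simpa using this
  have h2 := ((h1.tendsto_slope_zero).pow 2).const_mul 2
  unfold HasSecondOrder
  rw [show c ^ 2 / 2 = 2 * (c / 2) ^ 2 by ring]
  refine h2.congr fun w => ?_
  have h3 : Complex.cosh (w * c) = 2 * Complex.sinh (w * (c / 2)) ^ 2 + 1 := by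
    rw [show w * c = 2 * (w * (c / 2)) by ring, Complex.cosh_two_mul, Complex.cosh_sq]
    ring
  simp only [h3, zero_add, zero_mul, Complex.sinh_zero, sub_zero, smul_eq_mul]
  ring

lemma hasSecondOrder_sinh_div : HasSecondOrder (fun w => Complex.sinh w / w) (1 / 6) := by
  unfold HasSecondOrder
  rw [tendsto_iff_norm_sub_tendsto_zero]
  have h0 : Tendsto (fun w : ℂ => ‖w‖) (𝓝[≠] 0) (𝓝 0) := by
    have : ContinuousAt (fun w : ℂ => ‖w‖) 0 := by fun_prop
    simpa [ContinuousAt] using this.tendsto.mono_left nhdsWithin_le_nhds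
  refine squeeze_zero' (Eventually.of_forall fun _ => norm_nonneg _) ?_ h0
  have hball : ∀ᶠ w : ℂ in 𝓝[≠] 0, ‖w‖ < 1 := h0.eventually_lt_const one_pos
  filter_upwards [hball, self_mem_nhdsWithin] with w hw hw0
  have hw0 : w ≠ 0 := hw0
  have hb : ∀ v : ℂ, ‖v‖ ≤ 1 → ‖Complex.exp v - (1 + v + v ^ 2 / 2 + v ^ 3 / 6)‖ ≤ ‖v‖ ^ 4 := by
    intro v hv
    have := Complex.exp_bound hv (n := 4) (by norm_num)
    have hs : ∑ m ∈ Finset.range 4, v ^ m / (m.factorial : ℂ) =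
        1 + v + v ^ 2 / 2 + v ^ 3 / 6 := by
      simp [Finset.sum_range_succ, Nat.factorial]
    rw [hs] at this
    refine this.trans ?_
    have : ((Nat.succ 4 : ℝ) * ((Nat.factorial 4 : ℝ) * (4 : ℕ))⁻¹) ≤ 1 := by
      norm_num [Nat.factorial]
    exact mul_le_of_le_one_right (by positivity) this
  have e : (Complex.sinh w / w - 1) / w ^ 2 - 1 / 6 =
      ((Complex.exp w - (1 + w + w ^ 2 / 2 + w ^ 3 / 6)) -
        (Complex.exp (-w) - (1 + -w + (-w) ^ 2 / 2 + (-w) ^ 3 / 6))) / (2 * w ^ 3) := by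
    unfold Complex.sinh
    field_simp
    ring
  rw [e, norm_div, norm_mul, norm_pow, Complex.norm_ofNat, div_le_iff₀ (by positivity)]
  refine (norm_sub_le _ _).trans ?_
  have h1 := hb w hw.le
  have h2 := hb (-w) (by rw [norm_neg]; exact hw.le)
  rw [norm_neg] at h2
  calc _ ≤ ‖w‖ ^ 4 + ‖w‖ ^ 4 := add_le_add h1 h2
    _ = _ := by ring

lemma differentiableAt_cosh_div_sinh_cube {w : ℂ} (hw : Complex.sinh w ≠ 0) :
    DifferentiableAt ℂ (fun w => Complex.cosh w * (Complex.sinh w ^ 3)⁻¹) w :=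
  Complex.differentiableAt_cosh.mul
    ((Complex.differentiableAt_sinh.pow 3).inv (pow_ne_zero 3 hw))

lemma exists_norm_cosh_div_sinh_cube_le : ∃ C : ℝ, ∀ x y : ℝ, 1 ≤ |x| →
    ‖Complex.cosh (x + y * Complex.I) * (Complex.sinh (x + y * Complex.I) ^ 3)⁻¹‖ ≤
      C * Real.exp (-(2 * |x|)) := by
  set S := 2 / (1 - Real.exp (-(2 * 1))) with hS
  refine ⟨S ^ 3, fun x y hx => ?_⟩
  have h1 := norm_inv_sinh_le_of_le one_pos hx y
  have h2 : ‖Complex.cosh (x + y * Complex.I)‖ ≤ Real.exp |x| := by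
    unfold Complex.cosh
    rw [norm_div, Complex.norm_ofNat, div_le_iff₀ two_pos]
    refine (norm_add_le _ _).trans ?_
    rw [Complex.norm_exp, Complex.norm_exp]
    have e1 : Real.exp (x + y * Complex.I : ℂ).re ≤ Real.exp |x| := by
      gcongr; simpa using le_abs_self x
    have e2 : Real.exp (-(x + y * Complex.I : ℂ)).re ≤ Real.exp |x| := by
      gcongr; simpa using neg_le_abs x
    linarith
  rw [norm_mul, ← inv_pow, norm_pow]
  calc _ ≤ Real.exp |x| * (S * Real.exp (-|x|)) ^ 3 := by gcongr
    _ = S ^ 3 * (Real.exp |x| * (Real.exp (-|x|) * Real.exp (-|x|) * Real.exp (-|x|))) := by ring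
    _ = _ := by
      rw [← Real.exp_add, ← Real.exp_add, ← Real.exp_add]
      ring_nf

lemma integrable_cosh_div_sinh_cube {y : ℝ} (h0 : y ≠ 0) (h : |y| < π) :
    Integrable fun x : ℝ =>
      Complex.cosh (x + y * Complex.I) * (Complex.sinh (x + y * Complex.I) ^ 3)⁻¹ := by
  obtain ⟨C, hC⟩ := exists_norm_cosh_div_sinh_cube_le
  refine integrable_of_continuous_of_decay ?_ two_pos fun x hx => hC x y hx
  exact continuous_line_of_differentiableAt
    (f := fun w => Complex.cosh w * (Complex.sinh w ^ 3)⁻¹) fun x =>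
    differentiableAt_cosh_div_sinh_cube
      (sinh_ne_zero_of_abs_im_lt (line_ne_zero x h0) (by simpa using h))

lemma integral_cosh_div_sinh_cube {y : ℝ} (h0 : y ≠ 0) (h : |y| < π) :
    ∫ x : ℝ, Complex.cosh (x + y * Complex.I) * (Complex.sinh (x + y * Complex.I) ^ 3)⁻¹ = 0 := by
  have lim : ∀ {l : Filter ℝ}, Tendsto (fun x : ℝ => |x|) l atTop →
      Tendsto (fun x : ℝ => -(2 : ℂ)⁻¹ * ((Complex.sinh (x + y * Complex.I))⁻¹ ^ 2)) l (𝓝 0) := by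
    intro l hl
    have h1 : Tendsto (fun x : ℝ => (Complex.sinh (x + y * Complex.I))⁻¹) l (𝓝 0) := by
      have h2 : Tendsto (fun x : ℝ => 2 / (1 - Real.exp (-(2 * 1))) * Real.exp (-|x|)) l (𝓝 0) := by
        simpa using (Real.tendsto_exp_neg_atTop_nhds_zero.comp hl).const_mul
          (2 / (1 - Real.exp (-(2 * 1))))
      refine squeeze_zero_norm' ?_ h2
      filter_upwards [hl.eventually_ge_atTop 1] with x hx
      exact norm_inv_sinh_le_of_le one_pos hx y
    simpa using (h1.pow 2).const_mul (-(2 : ℂ)⁻¹)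
  have := integral_of_hasDerivAt_of_tendsto
    (f := fun x : ℝ => -(2 : ℂ)⁻¹ * ((Complex.sinh (x + y * Complex.I))⁻¹ ^ 2)) (fun x => ?_)
    (integrable_cosh_div_sinh_cube h0 h) (lim tendsto_abs_atBot_atTop) (lim tendsto_abs_atTop_atTop)
  · simpa using this
  · have hne := sinh_ne_zero_of_abs_im_lt (line_ne_zero x h0) (by simpa using h)
    have hl : HasDerivAt (fun x : ℝ => (x + y * Complex.I : ℂ)) 1 x :=
      (Complex.ofRealCLM.hasDerivAt (x := x)).add_const _
    have h1 := (Complex.hasDerivAt_sinh (x + y * Complex.I)).comp x hl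
    refine (((h1.inv hne).pow 2).const_mul (-(2 : ℂ)⁻¹)).congr_deriv ?_
    simp only [Function.comp_apply, Pi.inv_apply, Function.comp_def, Nat.cast_ofNat,
      Nat.add_one_sub_one, pow_one]
    field_simp

/-- The inversion relation of the quantum dilogarithm, in logarithmic form. -/
lemma dilogLog_add_neg {b : ℝ} (hb : 0 < b) {z : ℂ} (hz : |z.im| < (b + b⁻¹) / 2) :
    dilogLog b z + dilogLog b (-z) =
      Complex.I * π * (z ^ 2 + (b ^ 2 + (b⁻¹ : ℝ) ^ 2) / 12) := by
  set ε := ctrHeight b with hε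
  have hε0 : 0 < ε := ctrHeight_pos hb
  have hεπ : ε < π := ctrHeight_lt_pi hb
  have hbC : (b : ℂ) ≠ 0 := by exact_mod_cast hb.ne'
  set E : ℂ → ℂ := fun w => 2 * Complex.cosh (w * (2 * Complex.I * z)) * dilogKer b w with hE
  set Q : ℂ → ℂ := fun w => Complex.cosh w * (Complex.sinh w ^ 3)⁻¹ with hQ
  have eE : ∀ w, E w = dilogKer b w * Complex.exp (-2 * Complex.I * z * w) +
      dilogKer b w * Complex.exp (-2 * Complex.I * (-z) * w) := by
    intro w
    simp only [hE, Complex.cosh]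
    rw [show -(w * (2 * Complex.I * z)) = -2 * Complex.I * z * w by ring,
      show w * (2 * Complex.I * z) = -2 * Complex.I * (-z) * w by ring]
    ring
  have i1 := integrable_dilogLog hb hz
  have i2 := integrable_dilogLog hb (z := -z) (by simpa using hz)
  have hsum : dilogLog b z + dilogLog b (-z) = ∫ x : ℝ, E (x + ε * Complex.I) := by
    simp_rw [eE]
    rw [integral_add i1 i2]
    rfl
  have iE : Integrable fun x : ℝ => E (x + ε * Complex.I) := by
    simp_rw [eE]
    exact i1.add i2
  have iQ : Integrable fun x : ℝ => Q (x + ε * Complex.I) :=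
    integrable_cosh_div_sinh_cube hε0.ne' (by rwa [abs_of_pos hε0])
  set f : ℂ → ℂ := fun w => E w - 2⁻¹ * Q w with hf
  have hodd : ∀ w, f (-w) = -f w := by
    intro w
    simp only [hf, hE, hQ, neg_mul, Complex.cosh_neg, Complex.sinh_neg, dilogKer_neg]
    rw [neg_pow, show (-1 : ℂ) ^ 3 = -1 by norm_num, neg_mul, one_mul, inv_neg]
    ring
  set r : ℂ := 2⁻¹ * (-2 * z ^ 2 - (b ^ 2 + (b⁻¹ : ℝ) ^ 2) / 6) with hr
  obtain ⟨C₁, hC₁⟩ := exists_norm_dilogKer_le hb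
  obtain ⟨C₂, hC₂⟩ := exists_norm_cosh_div_sinh_cube_le
  have key := integral_line_sub_of_simplePole (f := f) (y₁ := -ε) (y₂ := ε) (r := r)
    (by linarith) (by linarith) hε0 hεπ (fun w hw h1 h2 => ?_) ?_ ?_
    (d := min (b + b⁻¹ - 2 * |z.im|) 2)
    (C := 2 * (Real.exp (2 * |z.re| * ε) * C₁) + 2⁻¹ * C₂) (lt_min (by linarith) two_pos) ?_
  · have e1 : ∫ x : ℝ, f (x + (-ε : ℝ) * Complex.I) = -∫ x : ℝ, f (x + ε * Complex.I) := by
      rw [← integral_neg_eq_self, ← integral_neg]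
      congr 1
      ext x
      rw [← hodd]
      congr 1
      push_cast
      ring
    have e2 : ∫ x : ℝ, f (x + ε * Complex.I) = ∫ x : ℝ, E (x + ε * Complex.I) := by
      simp only [hf]
      rw [integral_sub iE (iQ.const_mul _), integral_const_mul,
        integral_cosh_div_sinh_cube hε0.ne' (by rwa [abs_of_pos hε0])]
      ring
    rw [e1, e2] at key
    rw [hsum]
    linear_combination -(1 / 2 : ℂ) * key - Complex.I * π * hr
  · have hab : |w.im| ≤ ε := abs_le.mpr ⟨h1, h2⟩
    refine DifferentiableAt.sub (DifferentiableAt.mul (by fun_prop)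
      (differentiableAt_dilogKer hb hw hab)) (DifferentiableAt.const_mul ?_ _)
    exact differentiableAt_cosh_div_sinh_cube
      (sinh_ne_zero_of_abs_im_lt hw (hab.trans_lt hεπ))
  · simp [hf, hE, hQ, dilogKer]
  · have hbi : ((b⁻¹ : ℝ) : ℂ) ≠ 0 := by exact_mod_cast (inv_pos.mpr hb).ne'
    have t1 := ((hasSecondOrder_cosh (2 * Complex.I * z)).mul
      (hasSecondOrder_sinh_div.comp_mul_right hbC).inv).mul
      (hasSecondOrder_sinh_div.comp_mul_right hbi).inv
    have t2 := (hasSecondOrder_cosh 1).mul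
      ((hasSecondOrder_sinh_div.mul hasSecondOrder_sinh_div).mul hasSecondOrder_sinh_div).inv
    have t3 := (t1.sub t2).const_mul (2 : ℂ)⁻¹
    have er : r = 2⁻¹ * ((2 * Complex.I * z) ^ 2 / 2 + -((b : ℂ) ^ 2 * (1 / 6)) +
        -((b⁻¹ : ℝ) ^ 2 * (1 / 6)) - (1 ^ 2 / 2 + -(1 / 6 + 1 / 6 + 1 / 6))) := by
      rw [hr]
      linear_combination -(z ^ 2) * Complex.I_sq
    rw [er]
    refine t3.congr' ?_
    filter_upwards [self_mem_nhdsWithin,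
      (hasSecondOrder_sinh_div.comp_mul_right hbC).tendsto_one.eventually_ne one_ne_zero,
      (hasSecondOrder_sinh_div.comp_mul_right hbi).tendsto_one.eventually_ne one_ne_zero,
      hasSecondOrder_sinh_div.tendsto_one.eventually_ne one_ne_zero] with w hw n1 n2 n3
    have hw : w ≠ 0 := hw
    have m1 : Complex.sinh (w * b) ≠ 0 := (div_ne_zero_iff.mp n1).1
    have m2 : Complex.sinh (w * (b⁻¹ : ℝ)) ≠ 0 := (div_ne_zero_iff.mp n2).1
    have m3 : Complex.sinh w ≠ 0 := (div_ne_zero_iff.mp n3).1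
    simp only [hf, hE, hQ, dilogKer, mul_one]
    rw [show w / (b : ℂ) = w * (b⁻¹ : ℝ) by push_cast; rw [div_eq_mul_inv]]
    have hbb : (b : ℂ) * (b⁻¹ : ℝ) = 1 := by push_cast; exact mul_inv_cancel₀ hbC
    generalize ((b⁻¹ : ℝ) : ℂ) = β at *
    have hβ : β = (b : ℂ)⁻¹ := eq_inv_of_mul_eq_one_right hbb
    generalize Complex.sinh (w * b) = s1 at *
    generalize Complex.sinh (w * β) = s2 at *
    generalize Complex.sinh w = s3 at *
    generalize Complex.cosh w = c3 at *
    generalize Complex.cosh (w * (2 * Complex.I * z)) = c1 at *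
    subst hβ
    field_simp
    ring
  · intro x y hx h1 h2
    have hy : |y| ≤ ε := abs_le.mpr ⟨h1, h2⟩
    have hC1 : 0 ≤ C₁ := nonneg_of_mul_nonneg_left ((norm_nonneg _).trans (hC₁ x y hx))
      (Real.exp_pos _)
    have hC2 : 0 ≤ C₂ := nonneg_of_mul_nonneg_left ((norm_nonneg _).trans (hC₂ x y hx))
      (Real.exp_pos _)
    have hcosh : ‖Complex.cosh ((x + y * Complex.I) * (2 * Complex.I * z))‖ ≤
        Real.exp (2 * |z.re| * ε) * Real.exp (2 * |z.im| * |x|) := by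
      unfold Complex.cosh
      rw [norm_div, Complex.norm_ofNat, div_le_iff₀ two_pos, ← Real.exp_add]
      refine (norm_add_le _ _).trans ?_
      rw [Complex.norm_exp, Complex.norm_exp, Complex.neg_re]
      have hre : ((x + y * Complex.I) * (2 * Complex.I * z)).re =
          -(2 * (z.re * y)) - 2 * (z.im * x) := by
        simp
        ring
      have a1 : |z.re * y| ≤ |z.re| * ε := by rw [abs_mul]; gcongr
      have a2 : |z.im * x| ≤ |z.im| * |x| := (abs_mul _ _).le
      rw [abs_le] at a1 a2
      have e1 : Real.exp ((x + y * Complex.I) * (2 * Complex.I * z)).re ≤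
          Real.exp (2 * |z.re| * ε + 2 * |z.im| * |x|) := by
        gcongr; rw [hre]; linarith
      have e2 : Real.exp (-((x + y * Complex.I) * (2 * Complex.I * z)).re) ≤
          Real.exp (2 * |z.re| * ε + 2 * |z.im| * |x|) := by
        gcongr; rw [hre]; linarith
      linarith
    set d := min (b + b⁻¹ - 2 * |z.im|) 2
    have d1 : d ≤ b + b⁻¹ - 2 * |z.im| := min_le_left _ _
    have d2 : d ≤ 2 := min_le_right _ _
    have hE' : ‖E (x + y * Complex.I)‖ ≤
        2 * (Real.exp (2 * |z.re| * ε) * C₁) * Real.exp (-(d * |x|)) := by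
      simp only [hE]
      rw [norm_mul, norm_mul, Complex.norm_ofNat]
      calc _ ≤ 2 * (Real.exp (2 * |z.re| * ε) * Real.exp (2 * |z.im| * |x|)) *
            (C₁ * Real.exp (-((b + b⁻¹) * |x|))) := by
            gcongr
            exact hC₁ x y hx
        _ = 2 * (Real.exp (2 * |z.re| * ε) * C₁) *
            (Real.exp (2 * |z.im| * |x|) * Real.exp (-((b + b⁻¹) * |x|))) := by ring
        _ ≤ _ := by
          rw [← Real.exp_add]
          gcongr
          nlinarith
    have hQ' : ‖(2 : ℂ)⁻¹ * Q (x + y * Complex.I)‖ ≤ 2⁻¹ * C₂ * Real.exp (-(d * |x|)) := by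
      rw [norm_mul, norm_inv, Complex.norm_ofNat, mul_assoc]
      gcongr
      refine (hC₂ x y hx).trans ?_
      gcongr
    refine (norm_sub_le _ _).trans ?_
    rw [add_mul]
    exact add_le_add hE' hQ'

lemma differentiableAt_dilogInv {b : ℝ} (hb : 0 < b) {z : ℂ} (hz : |z.im| < (b + b⁻¹) / 2) :
    DifferentiableAt ℂ (dilogInv b) z :=
  (differentiableAt_dilogLog hb hz).neg.cexp

lemma conj_dilogInv (b : ℝ) (z : ℂ) :
    (starRingEnd ℂ) (dilogInv b z) = (dilogInv b ((starRingEnd ℂ) z))⁻¹ := by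
  unfold dilogInv
  rw [← Complex.exp_conj, map_neg, conj_dilogLog, ← Complex.exp_neg]

lemma norm_exp_neg_sub_one_le (u : ℂ) : ‖Complex.exp (-u) - 1‖ ≤ ‖u‖ * Real.exp ‖u‖ := by
  have := Complex.norm_exp_sub_sum_le_norm_mul_exp (-u) 1
  simpa using this

/-- On closed substrips, the reciprocal dilogarithm tends to `1` exponentially fast on the left. -/
lemma exists_norm_dilogInv_sub_one_le {b : ℝ} (hb : 0 < b) {Y : ℝ} (hY : Y < (b + b⁻¹) / 2) :
    ∃ C : ℝ, ∀ z : ℂ, |z.im| ≤ Y → z.re ≤ 0 →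
      ‖dilogInv b z - 1‖ ≤ C * Real.exp (2 * ctrHeight b * z.re) := by
  obtain ⟨C, hC⟩ := exists_norm_dilogLog_le hb hY
  refine ⟨C * Real.exp C, fun z hz hre => ?_⟩
  have h := hC z hz
  have hC0 : 0 ≤ C := nonneg_of_mul_nonneg_left ((norm_nonneg _).trans h) (Real.exp_pos _)
  have h1 : ‖dilogLog b z‖ ≤ C := h.trans (mul_le_of_le_one_right hC0
    (Real.exp_le_one_iff.mpr (by have := ctrHeight_pos hb; nlinarith)))
  calc ‖dilogInv b z - 1‖ ≤ ‖dilogLog b z‖ * Real.exp ‖dilogLog b z‖ :=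
        norm_exp_neg_sub_one_le _
    _ ≤ (C * Real.exp (2 * ctrHeight b * z.re)) * Real.exp C := by gcongr
    _ = _ := by ring

lemma exists_norm_dilogInv_le_of_nonneg {b : ℝ} (hb : 0 < b) {Y : ℝ} (hY : Y < (b + b⁻¹) / 2) :
    ∃ C : ℝ, ∀ z : ℂ, |z.im| ≤ Y → 0 ≤ z.re →
      ‖dilogInv b z‖ ≤ C * Real.exp (2 * π * z.re * z.im) := by
  obtain ⟨C, hC⟩ := exists_norm_dilogLog_le hb hY
  refine ⟨Real.exp C, fun z hz hre => ?_⟩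
  have h := hC (-z) (by simpa using hz)
  have hC0 : 0 ≤ C := nonneg_of_mul_nonneg_left ((norm_nonneg _).trans h) (Real.exp_pos _)
  have h1 : ‖dilogLog b (-z)‖ ≤ C := h.trans (mul_le_of_le_one_right hC0
    (Real.exp_le_one_iff.mpr (by have := ctrHeight_pos hb; rw [Complex.neg_re]; nlinarith)))
  have h2 := dilogLog_add_neg hb (hz.trans_lt hY)
  have h3 : -dilogLog b z =
      dilogLog b (-z) - Complex.I * π * (z ^ 2 + (b ^ 2 + (b⁻¹ : ℝ) ^ 2) / 12) := by
    linear_combination -h2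
  have h4 : (Complex.I * π * (z ^ 2 + (b ^ 2 + (b⁻¹ : ℝ) ^ 2) / 12)).re =
      -(2 * π * z.re * z.im) := by
    have : (z ^ 2 + (b ^ 2 + (b⁻¹ : ℝ) ^ 2) / 12 : ℂ) =
        z ^ 2 + (((b ^ 2 + b⁻¹ ^ 2) / 12 : ℝ) : ℂ) := by push_cast; ring
    rw [this]
    simp only [Complex.mul_re, Complex.mul_im, Complex.I_re, Complex.I_im, Complex.ofReal_re,
      Complex.ofReal_im, Complex.add_re, Complex.add_im, pow_two]
    ring
  unfold dilogInv
  rw [Complex.norm_exp, h3, Complex.sub_re, h4, sub_neg_eq_add, Real.exp_add]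
  gcongr
  exact (Complex.re_le_norm _).trans h1

/-- A one-sided bound for the reciprocal dilogarithm on closed substrips. -/
lemma exists_norm_dilogInv_le {b : ℝ} (hb : 0 < b) {Y : ℝ} (hY : Y < (b + b⁻¹) / 2) :
    ∃ C : ℝ, ∀ z : ℂ, |z.im| ≤ Y →
      ‖dilogInv b z‖ ≤ C * Real.exp (2 * π * max z.re 0 * z.im) := by
  obtain ⟨C₁, h₁⟩ := exists_norm_dilogInv_sub_one_le hb hY
  obtain ⟨C₂, h₂⟩ := exists_norm_dilogInv_le_of_nonneg hb hY
  refine ⟨max (C₁ + 1) C₂, fun z hz => ?_⟩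
  rcases le_total z.re 0 with h | h
  · have h3 := h₁ z hz h
    have hC0 : 0 ≤ C₁ := nonneg_of_mul_nonneg_left ((norm_nonneg _).trans h3) (Real.exp_pos _)
    have h4 : Real.exp (2 * ctrHeight b * z.re) ≤ 1 :=
      Real.exp_le_one_iff.mpr (by have := ctrHeight_pos hb; nlinarith)
    rw [max_eq_right h, mul_zero, zero_mul, Real.exp_zero, mul_one]
    refine le_trans ?_ (le_max_left _ _)
    calc ‖dilogInv b z‖ = ‖(dilogInv b z - 1) + 1‖ := by ring_nf
      _ ≤ ‖dilogInv b z - 1‖ + ‖(1 : ℂ)‖ := norm_add_le _ _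
      _ ≤ C₁ + 1 := by
        rw [norm_one]
        have := mul_le_of_le_one_right hC0 h4
        linarith
  · rw [max_eq_left h]
    refine (h₂ z hz h).trans ?_
    gcongr
    exact le_max_right _ _

lemma dilogInv_add_c {b : ℝ} (hb : 0 < b) {w : ℂ} (h1 : w.im < 0) (h2 : -b⁻¹ < w.im) :
    dilogInv b (w + ((b + b⁻¹) / 2 : ℝ) * Complex.I) =
      (1 - Complex.exp (2 * π * (b * w))) *
        dilogInv b (w + ((b⁻¹ - b) / 2 : ℝ) * Complex.I) := by
  have hbC : (b : ℂ) ≠ 0 := by exact_mod_cast hb.ne'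
  have h := dilogInv_shift hb (z := w + (b⁻¹ / 2 : ℝ) * Complex.I)
    (by rw [abs_lt]; simp; constructor <;> linarith)
  have e : Complex.exp (2 * π * (b * (w + (b⁻¹ / 2 : ℝ) * Complex.I))) =
      -Complex.exp (2 * π * (b * w)) := by
    rw [show (2 * π * (b * (w + (b⁻¹ / 2 : ℝ) * Complex.I)) : ℂ) =
      2 * π * (b * w) + π * Complex.I by push_cast; field_simp, Complex.exp_add,
      Complex.exp_pi_mul_I]
    ring
  rw [e, ← sub_eq_add_neg] at h
  convert h using 2
  · push_cast; ring
  · congr 1; push_cast; ring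

lemma dilogInv_ratio {b : ℝ} (hb : 0 < b) :
    b * dilogInv b (((b⁻¹ - b) / 2 : ℝ) * Complex.I) =
      (b⁻¹ : ℝ) * dilogInv b (-(((b⁻¹ - b) / 2 : ℝ) * Complex.I)) := by
  have hb' := inv_pos.mpr hb
  set e : ℂ := ((b⁻¹ - b) / 2 : ℝ) * Complex.I with he
  have hd : |((b⁻¹ - b) / 2 : ℝ)| < (b + b⁻¹) / 2 := by
    rw [abs_lt]; constructor <;> linarith
  have heq : ∀ᶠ v : ℝ in 𝓝[>] 0, ((1 - Complex.exp (2 * π * (b * (-(v * Complex.I))))) *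
      dilogInv b (-(v * Complex.I) + e)) = ((1 - Complex.exp (2 * π * ((b⁻¹ : ℝ) *
        (-(v * Complex.I))))) * dilogInv b (-(v * Complex.I) + -e)) := by
    filter_upwards [Ioo_mem_nhdsGT (lt_min hb hb')] with v hv
    have hv1 : v < b := hv.2.trans_le (min_le_left _ _)
    have hv2 : v < b⁻¹ := hv.2.trans_le (min_le_right _ _)
    have h1 := dilogInv_add_c hb (w := -(v * Complex.I)) (by simpa using hv.1) (by simpa using hv2)
    have h2 := dilogInv_add_c hb' (w := -(v * Complex.I)) (by simpa using hv.1)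
      (by simpa using hv1)
    rw [inv_inv, dilogInv_inv, dilogInv_inv, add_comm b⁻¹ b, h1] at h2
    rw [h2]
    congr 2
    rw [he]
    push_cast
    ring
  have lim : ∀ (l : ℝ) (d : ℂ), |d.im| < (b + b⁻¹) / 2 →
      Tendsto (fun v : ℝ => (v : ℂ)⁻¹ * ((1 - Complex.exp (2 * π * (l * (-(v * Complex.I))))) *
        dilogInv b (-(v * Complex.I) + d))) (𝓝[>] 0) (𝓝 (2 * π * l * Complex.I * dilogInv b d)) := by
    intro l d hd
    have hderiv : HasDerivAt (fun v : ℝ => 1 - Complex.exp (2 * π * (l * (-(v * Complex.I)))))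
        (2 * π * l * Complex.I) 0 := by
      have h0 : HasDerivAt (fun v : ℝ => (v : ℂ)) 1 0 := Complex.ofRealCLM.hasDerivAt
      have := (((h0.mul_const Complex.I).neg.const_mul (l : ℂ)).const_mul
        (2 * π : ℂ)).cexp.const_sub 1
      refine this.congr_deriv ?_
      simp
      ring
    have h1 := hderiv.tendsto_slope_zero.mono_left
      (nhdsWithin_mono (0 : ℝ) fun v (hv : 0 < v) => hv.ne')
    have h2 : Tendsto (fun v : ℝ => dilogInv b (-(v * Complex.I) + d)) (𝓝[>] 0)
        (𝓝 (dilogInv b d)) := by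
      have hc : ContinuousAt (dilogInv b) (-(((0 : ℝ) : ℂ) * Complex.I) + d) := by
        simpa using (differentiableAt_dilogInv hb hd).continuousAt
      have : ContinuousAt (fun v : ℝ => dilogInv b (-(v * Complex.I) + d)) 0 :=
        ContinuousAt.comp (f := fun v : ℝ => (-(v * Complex.I) + d : ℂ)) hc (by fun_prop)
      simpa [ContinuousAt] using this.tendsto.mono_left nhdsWithin_le_nhds
    refine (h1.mul h2).congr fun v => ?_
    simp [mul_assoc]
  have l1 := lim b e (by simpa [he] using hd)
  have l2 := lim b⁻¹ (-e) (by simpa [he] using hd)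
  have h3 := tendsto_nhds_unique l1 (l2.congr' (heq.mono fun v hv => by simp only [hv]))
  have hne : (2 * π * Complex.I : ℂ) ≠ 0 := Complex.two_pi_I_ne_zero
  refine mul_left_cancel₀ hne ?_
  linear_combination h3

/-- The value of the reciprocal dilogarithm at `i(𝖻⁻¹ - 𝖻)/2`. -/
lemma dilogInv_special {b : ℝ} (hb : 0 < b) :
    b * dilogInv b (((b⁻¹ - b) / 2 : ℝ) * Complex.I) =
      Complex.exp (Complex.I * π * (((b + b⁻¹) / 2 : ℝ) ^ 2 / 3 - 5 / 12)) := by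
  have hb' := inv_pos.mpr hb
  set δ : ℝ := (b⁻¹ - b) / 2 with hδ
  have hd : |δ| < (b + b⁻¹) / 2 := by
    rw [abs_lt, hδ]; constructor <;> linarith
  have h1 := dilogInv_ratio hb
  have h2 := dilogLog_add_neg hb (z := δ * Complex.I) (by simpa using hd)
  have h3 := conj_dilogLog b (δ * Complex.I)
  rw [map_mul, Complex.conj_ofReal, Complex.conj_I, mul_neg] at h3
  rw [← hδ] at h1
  set L := dilogLog b (δ * Complex.I) with hL
  have hneg : dilogLog b (-(δ * Complex.I)) = -(starRingEnd ℂ) L := by rw [h3, neg_neg]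
  have him : L.im = π * (-(δ ^ 2) + (b ^ 2 + b⁻¹ ^ 2) / 12) / 2 := by
    have h4 := congrArg Complex.im h2
    rw [hneg] at h4
    have e : (Complex.I * π * ((δ * Complex.I) ^ 2 + (b ^ 2 + (b⁻¹ : ℝ) ^ 2) / 12) : ℂ) =
        ((π * (-(δ ^ 2) + (b ^ 2 + b⁻¹ ^ 2) / 12) : ℝ) : ℂ) * Complex.I := by
      rw [mul_pow, Complex.I_sq]
      push_cast
      ring
    rw [e] at h4
    simp only [Complex.add_im, Complex.neg_im, Complex.conj_im, Complex.im_ofReal_mul,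
      Complex.I_im] at h4
    linarith
  have hre : Real.exp L.re = b := by
    unfold dilogInv at h1
    rw [hneg, neg_neg, ← hL] at h1
    have h5 := congrArg norm h1
    rw [norm_mul, norm_mul, Complex.norm_real, Complex.norm_real, Complex.norm_exp,
      Complex.norm_exp, Complex.neg_re, Complex.conj_re, Real.norm_of_nonneg hb.le,
      Real.norm_of_nonneg hb'.le, Real.exp_neg] at h5
    have h6 : Real.exp L.re ^ 2 = b ^ 2 := by
      have := Real.exp_pos L.re
      field_simp at h5
      linarith
    exact (pow_left_inj₀ (Real.exp_pos _).le hb.le two_ne_zero).mp h6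
  unfold dilogInv
  rw [← hL, ← Complex.re_add_im (-L), Complex.exp_add, Complex.neg_re, Complex.neg_im, him,
    ← Complex.ofReal_exp, Real.exp_neg, hre, ← mul_assoc, ← Complex.ofReal_mul,
    mul_inv_cancel₀ hb.ne', Complex.ofReal_one, one_mul]
  congr 1
  have hbC : (b : ℂ) ≠ 0 := by exact_mod_cast hb.ne'
  rw [hδ]
  push_cast
  field_simp
  ring

/-- Liouville's theorem for periodic entire functions of small exponential type. -/
lemma periodic_eq_of_norm_le_exp {f : ℂ → ℂ} {h C m : ℝ} (hh : 0 < h) (hf : Differentiable ℂ f)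
    (hp : Function.Periodic f h) (hm : m < 2 * π / h)
    (hb : ∀ z, ‖f z‖ ≤ C * Real.exp (m * |z.im|)) (z w : ℂ) : f z = f w := by
  have hC : 0 ≤ C := nonneg_of_mul_nonneg_left ((norm_nonneg _).trans (hb 0)) (Real.exp_pos _)
  set θ : ℝ := m * h / (2 * π) with hθ
  have hθ1 : θ < 1 := by
    rw [hθ, div_lt_one (by positivity)]
    rwa [lt_div_iff₀ hh] at hm
  set F := Function.Periodic.cuspFunction h f with hF
  have hFb : ∀ q : ℂ, q ≠ 0 → ‖F q‖ ≤ C * Real.exp (θ * |Real.log ‖q‖|) := fun q hq => by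
    rw [hF, Function.Periodic.cuspFunction_eq_of_nonzero h f hq]
    refine (hb _).trans (le_of_eq ?_)
    rw [Function.Periodic.im_invQParam, abs_mul, hθ, neg_div, abs_neg,
      abs_of_pos (by positivity : 0 < h / (2 * π))]
    ring_nf
  have hFd : ∀ q : ℂ, q ≠ 0 → DifferentiableAt ℂ F q := fun q hq => by
    rw [← Function.Periodic.qParam_right_inv hh.ne' hq]
    exact Function.Periodic.differentiableAt_cuspFunction hh.ne' hp (hf _)
  have hlog : Tendsto (fun q : ℂ => Real.log ‖q‖) (𝓝[≠] 0) atBot :=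
    Real.tendsto_log_nhdsNE_zero.comp (tendsto_norm_nhdsNE_zero.mono_right
      (nhdsWithin_mono _ fun x (hx : 0 < x) => hx.ne'))
  have hsmall : Tendsto (fun q : ℂ => q * F q) (𝓝[≠] 0) (𝓝 0) := by
    have h1 : Tendsto (fun q : ℂ => C * Real.exp ((1 - θ) * Real.log ‖q‖)) (𝓝[≠] 0) (𝓝 0) := by
      rw [← mul_zero C]
      exact (Real.tendsto_exp_atBot.comp
        (hlog.const_mul_atBot (sub_pos.mpr hθ1))).const_mul C
    refine squeeze_zero_norm' ?_ h1
    filter_upwards [hlog.eventually_le_atBot 0, self_mem_nhdsWithin] with q hq hq0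
    rw [norm_mul]
    have := hFb q hq0
    rw [abs_of_nonpos hq] at this
    calc ‖q‖ * ‖F q‖ ≤ Real.exp (Real.log ‖q‖) * (C * Real.exp (θ * -Real.log ‖q‖)) := by
          rw [Real.exp_log (norm_pos_iff.mpr hq0)]; gcongr
      _ = _ := by rw [mul_left_comm, ← Real.exp_add]; ring_nf
  have hFdiff : Differentiable ℂ F := by
    have ho : (fun q => F q - F 0) =o[𝓝[≠] 0] fun q : ℂ => (q - 0)⁻¹ := by
      refine Asymptotics.isLittleO_of_tendsto' ?_ ?_
      · filter_upwards [self_mem_nhdsWithin] with q hq h0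
        simp only [sub_zero, inv_eq_zero] at h0
        exact absurd h0 hq
      · have h2 : Tendsto (fun q : ℂ => q * F q - q * F 0) (𝓝[≠] 0) (𝓝 (0 - 0 * F 0)) :=
          hsmall.sub ((tendsto_id.mono_left nhdsWithin_le_nhds).mul_const _)
        simpa [div_inv_eq_mul, mul_comm, mul_sub] using h2
    have := Complex.differentiableOn_update_limUnder_of_isLittleO (s := univ) univ_mem
      (fun q hq => (hFd q hq.2).differentiableWithinAt) ho
    rw [hF, ← Function.Periodic.cuspFunction_zero_eq_limUnder_nhds_ne, Function.update_eq_self] at this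
    exact differentiableOn_univ.mp this
  have hd : Differentiable ℂ (dslope F 0) := by
    rw [← differentiableOn_univ, Complex.differentiableOn_dslope univ_mem]
    exact differentiableOn_univ.mpr hFdiff
  have hlog' : Tendsto (fun q : ℂ => Real.log ‖q‖) (cocompact ℂ) atTop :=
    Real.tendsto_log_atTop.comp (tendsto_norm_cocompact_atTop)
  have hlim : Tendsto (dslope F 0) (cocompact ℂ) (𝓝 0) := by
    have h1 : Tendsto (fun q : ℂ => C * Real.exp (-((1 - θ) * Real.log ‖q‖))) (cocompact ℂ)
        (𝓝 0) := by
      rw [← mul_zero C]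
      exact (Real.tendsto_exp_neg_atTop_nhds_zero.comp
        (hlog'.const_mul_atTop (sub_pos.mpr hθ1))).const_mul C
    have h2 : Tendsto (fun q : ℂ => ‖F 0‖ * ‖q‖⁻¹) (cocompact ℂ) (𝓝 0) := by
      rw [← mul_zero ‖F 0‖]
      exact (tendsto_inv_atTop_zero.comp tendsto_norm_cocompact_atTop).const_mul _
    have h3 := h1.add h2
    rw [add_zero] at h3
    refine squeeze_zero_norm' ?_ h3
    filter_upwards [hlog'.eventually_gt_atTop 0] with q hq
    have hq0 : q ≠ 0 := by rintro rfl; simp at hq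
    have hqn := norm_pos_iff.mpr hq0
    have h4 := hFb q hq0
    rw [abs_of_pos hq] at h4
    rw [dslope_of_ne _ hq0, slope_def_module, sub_zero, norm_smul, norm_inv]
    calc ‖q‖⁻¹ * ‖F q - F 0‖ ≤ ‖q‖⁻¹ * (C * Real.exp (θ * Real.log ‖q‖) + ‖F 0‖) := by
          gcongr; exact (norm_sub_le _ _).trans (by gcongr)
      _ = _ := by
          have : ‖q‖⁻¹ = Real.exp (-Real.log ‖q‖) := by rw [Real.exp_neg, Real.exp_log hqn]
          rw [mul_add, mul_comm ‖q‖⁻¹ ‖F 0‖, this, mul_left_comm, ← Real.exp_add]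
          ring_nf
  have hconst : ∀ q, F q = F 0 := fun q => by
    have := sub_smul_dslope F 0 q
    rw [hd.apply_eq_of_tendsto_cocompact q hlim, smul_zero] at this
    exact (sub_eq_zero.mp this.symm)
  rw [← Function.Periodic.eq_cuspFunction hh.ne' hp z,
    ← Function.Periodic.eq_cuspFunction hh.ne' hp w]
  exact (hconst _).trans (hconst _).symm

/-- A holomorphic function on a horizontal strip which is periodic in the imaginary direction and of
small exponential type is constant. -/
lemma eq_of_periodic_strip {R : ℂ → ℂ} {h C m α β γ : ℝ} (hh : 0 < h) (hα : α < γ)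
    (hβ : γ + h < β) (hR : ∀ w : ℂ, α < w.im → w.im < β → DifferentiableAt ℂ R w)
    (hp : ∀ w : ℂ, α + h < w.im → w.im < β → R (w - h * Complex.I) = R w) (hm : m < 2 * π / h)
    (hb : ∀ w : ℂ, γ ≤ w.im → w.im ≤ γ + h → ‖R w‖ ≤ C * Real.exp (m * |w.re|))
    {z w : ℂ} (hz : γ ≤ z.im) (hz' : z.im < γ + h) (hw : γ ≤ w.im) (hw' : w.im < γ + h) :
    R z = R w := by
  set n : ℂ → ℤ := fun w => ⌊(w.im - γ) / h⌋ with hn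
  set E : ℂ → ℂ := fun w => R (w - (n w : ℝ) * h * Complex.I) with hE
  have hn_iff : ∀ (w : ℂ) (k : ℤ), n w = k ↔ k * h ≤ w.im - γ ∧ w.im - γ < (k + 1) * h := by
    intro w k
    rw [hn, Int.floor_eq_iff, le_div_iff₀ hh, div_lt_iff₀ hh]
  have hn_self : ∀ w, n w * h ≤ w.im - γ ∧ w.im - γ < (n w + 1) * h := fun w => (hn_iff w _).mp rfl
  have him : ∀ (w : ℂ) (k : ℤ), (w - (k : ℝ) * h * Complex.I).im = w.im - k * h := by simp
  have hEd : Differentiable ℂ E := by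
    intro w₀
    obtain ⟨h1, h2⟩ := hn_self w₀
    have hev : E =ᶠ[𝓝 w₀] fun w => R (w - (n w₀ : ℝ) * h * Complex.I) := by
      have h3 : ∀ᶠ w : ℂ in 𝓝 w₀, max α (γ - h) + n w₀ * h < w.im :=
        Complex.continuous_im.continuousAt.eventually (lt_mem_nhds (by
          have : max α (γ - h) < γ := max_lt hα (by linarith)
          show _ < w₀.im
          linarith))
      have h4 : ∀ᶠ w : ℂ in 𝓝 w₀, w.im < γ + (n w₀ + 1) * h :=
        Complex.continuous_im.continuousAt.eventually (gt_mem_nhds (by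
          show w₀.im < _
          linarith))
      filter_upwards [h3, h4] with w h3 h4
      have h5 := le_max_left α (γ - h)
      have h6 := le_max_right α (γ - h)
      rcases le_or_gt (n w₀ * h : ℝ) (w.im - γ) with h7 | h7
      · have : n w = n w₀ := (hn_iff w _).mpr ⟨h7, by linarith⟩
        simp only [hE, this]
      · have : n w = n w₀ - 1 := (hn_iff w _).mpr ⟨by push_cast; linarith, by push_cast; linarith⟩
        simp only [hE, this]
        rw [← hp]
        · congr 1; push_cast; ring
        · rw [him]; push_cast; linarith
        · rw [him]; push_cast; linarith
    refine DifferentiableAt.congr_of_eventuallyEq ?_ hev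
    refine (hR _ ?_ ?_).comp w₀ (by fun_prop)
    · rw [him]; linarith
    · rw [him]; linarith
  have hEp : ∀ w, E (w + h * Complex.I) = E w := fun w => by
    have : n (w + h * Complex.I) = n w + 1 := by
      rw [hn_iff]
      have := hn_self w
      simp
      constructor <;> linarith
    simp only [hE, this]
    congr 1; push_cast; ring
  have hEb : ∀ w, ‖E w‖ ≤ C * Real.exp (m * |w.re|) := fun w => by
    have h1 := hn_self w
    have := hb (w - (n w : ℝ) * h * Complex.I) (by rw [him]; linarith) (by rw [him]; linarith)
    simpa [hE] using this
  have hER : ∀ w : ℂ, γ ≤ w.im → w.im < γ + h → E w = R w := fun w h1 h2 => by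
    have : n w = 0 := (hn_iff w 0).mpr ⟨by simp [h1], by simp; linarith⟩
    simp [hE, this]
  have key := periodic_eq_of_norm_le_exp (f := fun τ => E (Complex.I * τ)) (C := C) (m := m) hh
    (hEd.comp (by fun_prop)) (fun τ => by
      have := hEp (Complex.I * τ)
      simp only [mul_add]
      rw [← this, mul_comm Complex.I (h : ℂ)]) hm
    (fun τ => by simpa using hEb (Complex.I * τ)) (-Complex.I * z) (-Complex.I * w)
  have hI : ∀ u : ℂ, Complex.I * (-Complex.I * u) = u := fun u => by
    rw [← mul_assoc]; simp
  simp only [hI] at key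
  rw [← hER z hz hz', ← hER w hw hw', key]

/-- Strip version of Liouville's theorem, with the conclusion on the whole strip. -/
lemma eq_of_periodic_strip' {R : ℂ → ℂ} {h C m α β γ : ℝ} (hh : 0 < h) (hα : α < γ)
    (hβ : γ + h < β) (hR : ∀ w : ℂ, α < w.im → w.im < β → DifferentiableAt ℂ R w)
    (hp : ∀ w : ℂ, α + h < w.im → w.im < β → R (w - h * Complex.I) = R w) (hm : m < 2 * π / h)
    (hb : ∀ w : ℂ, γ ≤ w.im → w.im ≤ γ + h → ‖R w‖ ≤ C * Real.exp (m * |w.re|))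
    {z w : ℂ} (hz : α < z.im) (hz' : z.im < β) (hw : α < w.im) (hw' : w.im < β) :
    R z = R w := by
  set U : Set ℂ := {z | α < z.im} ∩ {z | z.im < β} with hU
  have hUo : IsOpen U := (isOpen_lt continuous_const Complex.continuous_im).inter
    (isOpen_lt Complex.continuous_im continuous_const)
  have hUc : IsPreconnected U :=
    ((convex_halfSpace_im_gt α).inter (convex_halfSpace_im_lt β)).isPreconnected
  have hRa : AnalyticOnNhd ℂ R U := DifferentiableOn.analyticOnNhd
    (fun z hz => (hR z hz.1 hz.2).differentiableWithinAt) hUo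
  set z₀ : ℂ := (γ + h / 2 : ℝ) * Complex.I with hz₀
  have hi : z₀.im = γ + h / 2 := by simp [hz₀]
  have hev : R =ᶠ[𝓝 z₀] fun _ => R z₀ := by
    have h1 : ∀ᶠ w : ℂ in 𝓝 z₀, γ < w.im := Complex.continuous_im.continuousAt.eventually
      (lt_mem_nhds (by linarith))
    have h2 : ∀ᶠ w : ℂ in 𝓝 z₀, w.im < γ + h := Complex.continuous_im.continuousAt.eventually
      (gt_mem_nhds (by linarith))
    filter_upwards [h1, h2] with w h1 h2
    exact eq_of_periodic_strip hh hα hβ hR hp hm hb h1.le h2 (by linarith) (by linarith)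
  have := hRa.eqOn_of_preconnected_of_eventuallyEq (fun _ _ => analyticAt_const) hUc
    (show z₀ ∈ U from ⟨show α < z₀.im by linarith, show z₀.im < β by linarith⟩) hev
  exact (this ⟨hz, hz'⟩).trans (this ⟨hw, hw'⟩).symm

/-- The Fourier integral of `f` along the horizontal line of height `y`. -/
def lineFourier (f : ℂ → ℂ) (y : ℝ) (w : ℂ) : ℂ :=
  ∫ x : ℝ, f (x + y * Complex.I) * Complex.exp (2 * π * Complex.I * w * (x + y * Complex.I))

/-- Holomorphy in the closed strip `y₁ ≤ Im z ≤ y₂`, with the growth of `e^{2πβ Re z}` on the left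
and of `e^{2π Re z Im z}` on the right. -/
structure StripDecay (f : ℂ → ℂ) (y₁ y₂ β C : ℝ) : Prop where
  diff : ∀ z : ℂ, y₁ ≤ z.im → z.im ≤ y₂ → DifferentiableAt ℂ f z
  left : ∀ z : ℂ, y₁ ≤ z.im → z.im ≤ y₂ → z.re ≤ 0 → ‖f z‖ ≤ C * Real.exp (2 * π * β * z.re)
  right : ∀ z : ℂ, y₁ ≤ z.im → z.im ≤ y₂ → 0 ≤ z.re → ‖f z‖ ≤ C * Real.exp (2 * π * z.re * z.im)
  le : y₂ ≤ β

namespace StripDecay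

variable {f : ℂ → ℂ} {y₁ y₂ β C : ℝ}

lemma nonneg (h : StripDecay f y₁ y₂ β C) (hy : y₁ ≤ y₂) : 0 ≤ C :=
  nonneg_of_mul_nonneg_left ((norm_nonneg _).trans
    (h.right (y₁ * Complex.I) (by simp) (by simpa) (by simp))) (Real.exp_pos _)

lemma continuous (h : StripDecay f y₁ y₂ β C) {y : ℝ} (h1 : y₁ ≤ y) (h2 : y ≤ y₂) :
    Continuous fun x : ℝ => f (x + y * Complex.I) :=
  continuous_line_of_differentiableAt fun x => h.diff _ (by simpa) (by simpa)

lemma bound_left (h : StripDecay f y₁ y₂ β C) {y : ℝ} (h1 : y₁ ≤ y) (h2 : y ≤ y₂) (x : ℝ) :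
    ‖f (x + y * Complex.I)‖ ≤ C * Real.exp (-(-(2 * π * β) * x)) := by
  have hC := h.nonneg (h1.trans h2)
  have hβ := h.le
  rcases le_total x 0 with hx | hx
  · have := h.left (x + y * Complex.I) (by simpa) (by simpa) (by simpa)
    simpa using this
  · have := h.right (x + y * Complex.I) (by simpa) (by simpa) (by simpa)
    simp only [Complex.add_re, Complex.ofReal_re, Complex.mul_re, Complex.I_re, Complex.ofReal_im,
      Complex.I_im, Complex.add_im, Complex.mul_im, mul_zero, mul_one, sub_zero, add_zero,
      zero_add] at this
    refine this.trans ?_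
    gcongr
    have : x * y ≤ x * β := by gcongr; linarith
    nlinarith [pi_pos]

lemma bound_right (h : StripDecay f y₁ y₂ β C) {y : ℝ} (h1 : y₁ ≤ y) (h2 : y ≤ y₂) (x : ℝ) :
    ‖f (x + y * Complex.I)‖ ≤ C * Real.exp (-(-(2 * π * y) * x)) := by
  have hC := h.nonneg (h1.trans h2)
  have hβ := h.le
  rcases le_total x 0 with hx | hx
  · have := h.left (x + y * Complex.I) (by simpa) (by simpa) (by simpa)
    simp only [Complex.add_re, Complex.ofReal_re, Complex.mul_re, Complex.I_re, Complex.ofReal_im,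
      Complex.I_im, mul_zero, mul_one, sub_zero, add_zero] at this
    refine this.trans ?_
    gcongr
    have : x * β ≤ x * y := mul_le_mul_of_nonpos_left (by linarith) hx
    nlinarith [pi_pos]
  · have := h.right (x + y * Complex.I) (by simpa) (by simpa) (by simpa)
    simp only [Complex.add_re, Complex.ofReal_re, Complex.mul_re, Complex.I_re, Complex.ofReal_im,
      Complex.I_im, Complex.add_im, Complex.mul_im, mul_zero, mul_one, sub_zero, add_zero,
      zero_add] at this
    convert this using 3
    ring

lemma re_two_pi_I_mul (w : ℂ) : (2 * π * Complex.I * w).re = -(2 * π * w.im) := by simp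

lemma im_two_pi_I_mul (w : ℂ) : (2 * π * Complex.I * w).im = 2 * π * w.re := by simp

lemma integrable (h : StripDecay f y₁ y₂ β C) {y : ℝ} (h1 : y₁ ≤ y) (h2 : y ≤ y₂) {w : ℂ}
    (hw : y < w.im) (hw' : w.im < β) :
    Integrable fun x : ℝ => f (x + y * Complex.I) *
      Complex.exp (2 * π * Complex.I * w * (x + y * Complex.I)) :=
  integrable_lineLaplace (h.continuous h1 h2) (h.bound_left h1 h2) (h.bound_right h1 h2) y
    (by rw [re_two_pi_I_mul]; nlinarith [pi_pos]) (by rw [re_two_pi_I_mul]; nlinarith [pi_pos])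

lemma differentiableAt (h : StripDecay f y₁ y₂ β C) {y : ℝ} (h1 : y₁ ≤ y) (h2 : y ≤ y₂) {w : ℂ}
    (hw : y < w.im) (hw' : w.im < β) : DifferentiableAt ℂ (lineFourier f y) w := by
  have := hasDerivAt_lineLaplace (s := 2 * π * Complex.I * w) (h.continuous h1 h2)
    (h.bound_left h1 h2) (h.bound_right h1 h2) y
    (by rw [re_two_pi_I_mul]; nlinarith [pi_pos]) (by rw [re_two_pi_I_mul]; nlinarith [pi_pos])
  exact this.differentiableAt.comp w (by fun_prop : DifferentiableAt ℂ
    (fun w : ℂ => 2 * π * Complex.I * w) w)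

lemma norm_le (h : StripDecay f y₁ y₂ β C) {y : ℝ} (h1 : y₁ ≤ y) (h2 : y ≤ y₂) {d : ℝ}
    (hd : 0 < d) {w : ℂ} (hw : y + d ≤ w.im) (hw' : w.im + d ≤ β) :
    ‖lineFourier f y w‖ ≤
      (∫ x : ℝ, C * Real.exp (-(2 * π * d * |x|))) * Real.exp (-(2 * π * w.re * y)) := by
  have := norm_lineLaplace_le (s := 2 * π * Complex.I * w) (d := 2 * π * d)
    (h.bound_left h1 h2) (h.bound_right h1 h2) y (by positivity)
    (by rw [re_two_pi_I_mul]; nlinarith [pi_pos]) (by rw [re_two_pi_I_mul]; nlinarith [pi_pos])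
  rwa [im_two_pi_I_mul] at this

lemma lineFourier_eq (h : StripDecay f y₁ y₂ β C) (hy : y₁ ≤ y₂) {w : ℂ}
    (hw : y₂ < w.im) (hw' : w.im < β) : lineFourier f y₁ w = lineFourier f y₂ w := by
  set d := min (w.im - y₂) (β - w.im) with hd
  have hd0 : 0 < d := lt_min (by linarith) (by linarith)
  have hd1 : d ≤ w.im - y₂ := min_le_left _ _
  have hd2 : d ≤ β - w.im := min_le_right _ _
  have hC := h.nonneg hy
  refine integral_line_eq_of_le
    (f := fun z => f z * Complex.exp (2 * π * Complex.I * w * z)) hy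
    (fun z hz hz' => (h.diff z hz hz').mul (by fun_prop))
    (h.integrable le_rfl hy (by linarith) hw') (h.integrable hy le_rfl hw hw')
    (d := 2 * π * d) (C := C * Real.exp (2 * π * |w.re| * (|y₁| + |y₂|))) (by positivity) ?_
  intro x y _ h1 h2
  have h3 := norm_kernel_mul_exp_le (s := 2 * π * Complex.I * w) (d := 2 * π * d)
    (h.bound_left h1 h2) (h.bound_right h1 h2) y
    (by rw [re_two_pi_I_mul]; nlinarith [pi_pos]) (by rw [re_two_pi_I_mul]; nlinarith [pi_pos]) x
  refine h3.trans ?_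
  rw [im_two_pi_I_mul]
  gcongr
  have h4 : |y| ≤ |y₁| + |y₂| := by
    rcases le_total y 0 with hy0 | hy0
    · rw [abs_of_nonpos hy0]; linarith [neg_le_abs y₁, abs_nonneg y₂]
    · rw [abs_of_nonneg hy0]; linarith [le_abs_self y₂, abs_nonneg y₁]
  calc -(2 * π * w.re * y) ≤ |2 * π * w.re * y| := neg_le_abs _
    _ = 2 * π * |w.re| * |y| := by
      rw [abs_mul, abs_mul, abs_of_pos (by positivity : 0 < 2 * π)]
    _ ≤ _ := by gcongr

lemma mono (h : StripDecay f y₁ y₂ β C) {z₁ z₂ : ℝ} (h1 : y₁ ≤ z₁) (h2 : z₂ ≤ y₂) :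
    StripDecay f z₁ z₂ β C where
  diff z hz hz' := h.diff z (h1.trans hz) (hz'.trans h2)
  left z hz hz' := h.left z (h1.trans hz) (hz'.trans h2)
  right z hz hz' := h.right z (h1.trans hz) (hz'.trans h2)
  le := h2.trans h.le

lemma lineFourier_eq' (h : StripDecay f y₁ y₂ β C) {z₁ z₂ : ℝ} (h1 : y₁ ≤ z₁) (h12 : z₁ ≤ z₂)
    (h2 : z₂ ≤ y₂) {w : ℂ} (hw : z₂ < w.im) (hw' : w.im < β) :
    lineFourier f z₁ w = lineFourier f z₂ w :=
  (h.mono h1 h2).lineFourier_eq h12 hw hw'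

end StripDecay

/-- Shifting the argument of `f` vertically shifts the line and multiplies by an exponential. -/
lemma lineFourier_comp_add (f : ℂ → ℂ) (y h : ℝ) (w : ℂ) :
    lineFourier (fun z => f (z + h * Complex.I)) y w =
      Complex.exp (2 * π * h * w) * lineFourier f (y + h) w := by
  unfold lineFourier
  rw [← integral_const_mul]
  refine integral_congr_ae (ae_of_all _ fun x => ?_)
  simp only [Complex.ofReal_add]
  rw [mul_left_comm, ← Complex.exp_add]
  congr 2
  · ring
  · have := Complex.I_mul_I
    linear_combination (-2 * π * h * w : ℂ) * this

lemma integrable_comp_add {f : ℂ → ℂ} {y h : ℝ} {w : ℂ}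
    (hf : Integrable fun x : ℝ => f (x + (y + h : ℝ) * Complex.I) *
      Complex.exp (2 * π * Complex.I * w * (x + (y + h : ℝ) * Complex.I))) :
    Integrable fun x : ℝ => f (x + y * Complex.I + h * Complex.I) *
      Complex.exp (2 * π * Complex.I * w * (x + y * Complex.I)) := by
  refine (hf.const_mul (Complex.exp (2 * π * h * w))).congr (ae_of_all _ fun x => ?_)
  simp only [Complex.ofReal_add]
  rw [mul_left_comm, ← Complex.exp_add]
  congr 2
  · ring
  · linear_combination (2 * π * h * w : ℂ) * Complex.I_mul_I

lemma exists_stripDecay_dilogInv {b : ℝ} (hb : 0 < b) {y₁ y₂ : ℝ} (h1 : -((b + b⁻¹) / 2) < y₁)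
    (h2 : y₂ ≤ 0) : ∃ C, StripDecay (dilogInv b) y₁ y₂ 0 C := by
  have hY : -y₁ < (b + b⁻¹) / 2 := by linarith
  obtain ⟨C, hC⟩ := exists_norm_dilogInv_le hb hY
  have habs : ∀ z : ℂ, y₁ ≤ z.im → z.im ≤ y₂ → |z.im| ≤ -y₁ := fun z hz hz' => by
    rw [abs_of_nonpos (by linarith)]; linarith
  refine ⟨C, fun z hz hz' => differentiableAt_dilogInv hb ((habs z hz hz').trans_lt hY),
    fun z hz hz' hre => ?_, fun z hz hz' hre => ?_, h2⟩
  · simpa [max_eq_right hre] using hC z (habs z hz hz')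
  · simpa [max_eq_left hre] using hC z (habs z hz hz')

/-- The vertical difference `G(z) - G(z - iη)` of the reciprocal dilogarithm `G`. -/
def dilogDiff (b η : ℝ) (z : ℂ) : ℂ := dilogInv b z - dilogInv b (z - η * Complex.I)

lemma two_mul_ctrHeight {b : ℝ} (hb : 0 < b) (hb1 : b ≤ 1) : 2 * ctrHeight b = 2 * π * (b / 2) := by
  have : b ≤ b⁻¹ := hb1.trans ((one_le_inv₀ hb).mpr hb1)
  rw [ctrHeight, min_eq_left this]; ring

lemma exists_stripDecay_dilogDiff {b : ℝ} (hb : 0 < b) (hb1 : b ≤ 1) {y₁ y₂ η : ℝ} (hη : 0 ≤ η)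
    (h1 : -((b + b⁻¹) / 2) < y₁ - η) (h2 : y₂ ≤ b / 2) :
    ∃ C, StripDecay (dilogDiff b η) y₁ y₂ (b / 2) C := by
  have hbi : 0 < b⁻¹ := inv_pos.mpr hb
  set Y := max (b / 2) (η - y₁) with hYdef
  have hY : Y < (b + b⁻¹) / 2 := max_lt (by linarith) (by linarith)
  have hY1 : b / 2 ≤ Y := le_max_left _ _
  have hY2 : η - y₁ ≤ Y := le_max_right _ _
  obtain ⟨C₁, hC₁⟩ := exists_norm_dilogInv_sub_one_le hb hY
  obtain ⟨C₂, hC₂⟩ := exists_norm_dilogInv_le_of_nonneg hb hY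
  have him : ∀ z : ℂ, (z - η * Complex.I).im = z.im - η := by simp
  have hre' : ∀ z : ℂ, (z - η * Complex.I).re = z.re := by simp
  have habs : ∀ z : ℂ, y₁ ≤ z.im → z.im ≤ y₂ → |z.im| ≤ Y := fun z hz hz' =>
    abs_le.mpr ⟨by linarith, by linarith⟩
  have habs' : ∀ z : ℂ, y₁ ≤ z.im → z.im ≤ y₂ → |(z - η * Complex.I).im| ≤ Y := fun z hz hz' => by
    rw [him]; exact abs_le.mpr ⟨by linarith, by linarith⟩
  have hle : ∀ (C : ℝ), C = C₁ ∨ C = C₂ → C ≤ |C₁| + |C₂| := by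
    rintro C (rfl | rfl)
    · linarith [le_abs_self C, abs_nonneg C₂]
    · linarith [le_abs_self C, abs_nonneg C₁]
  refine ⟨2 * (|C₁| + |C₂|), fun z hz hz' => ?_, fun z hz hz' hre => ?_, fun z hz hz' hre => ?_, h2⟩
  · exact (differentiableAt_dilogInv hb ((habs z hz hz').trans_lt hY)).sub
      (DifferentiableAt.comp (g := dilogInv b) z
        (differentiableAt_dilogInv hb ((habs' z hz hz').trans_lt hY))
        (differentiableAt_id.sub_const _))
  · have h3 := hC₁ z (habs z hz hz') hre
    have h4 := hC₁ _ (habs' z hz hz') (by rwa [hre'])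
    rw [hre'] at h4
    rw [two_mul_ctrHeight hb hb1] at h3 h4
    calc ‖dilogDiff b η z‖
        = ‖(dilogInv b z - 1) - (dilogInv b (z - η * Complex.I) - 1)‖ := by
          rw [dilogDiff]; congr 1; ring
      _ ≤ ‖dilogInv b z - 1‖ + ‖dilogInv b (z - η * Complex.I) - 1‖ := norm_sub_le _ _
      _ ≤ 2 * (C₁ * Real.exp (2 * π * (b / 2) * z.re)) := by linarith
      _ ≤ _ := by
        rw [mul_assoc 2 (|C₁| + |C₂|)]
        gcongr
        exact hle _ (Or.inl rfl)
  · have h3 := hC₂ z (habs z hz hz') hre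
    have h4 := hC₂ _ (habs' z hz hz') (by rwa [hre'])
    rw [hre', him] at h4
    have h5 : ∀ e, e ≤ 2 * π * z.re * z.im → C₂ * Real.exp e ≤
        (|C₁| + |C₂|) * Real.exp (2 * π * z.re * z.im) := fun e he => by
      gcongr
      exact hle _ (Or.inr rfl)
    have h6 := h5 (2 * π * z.re * (z.im - η)) (by gcongr; linarith)
    have h7 := h5 _ le_rfl
    rw [dilogDiff]
    exact (norm_sub_le _ _).trans (by linarith)

/-- The Fourier integral of the vertical difference in terms of that of the reciprocal
dilogarithm. -/
lemma lineFourier_dilogDiff {b : ℝ} (hb : 0 < b) {y η : ℝ} (hη : 0 ≤ η)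
    (h1 : -((b + b⁻¹) / 2) < y - η) {w : ℂ} (hw : y < w.im) (hw' : w.im < 0) :
    lineFourier (dilogDiff b η) y w =
      (1 - Complex.exp (-(2 * π * η * w))) * lineFourier (dilogInv b) y w := by
  obtain ⟨C, hC⟩ := exists_stripDecay_dilogInv hb h1 (y₂ := y) (by linarith)
  have hsub : y - η ≤ y := by linarith
  have h2 := lineFourier_comp_add (dilogInv b) y (-η) w
  have h3 := hC.lineFourier_eq hsub hw hw'
  have hfun : (fun z : ℂ => dilogInv b (z + (-η : ℝ) * Complex.I)) =
      fun z => dilogInv b (z - η * Complex.I) := by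
    funext z; congr 1; push_cast; ring
  have hint1 := hC.integrable hsub le_rfl hw hw'
  have hint2 : Integrable fun x : ℝ => dilogInv b (x + y * Complex.I - η * Complex.I) *
      Complex.exp (2 * π * Complex.I * w * (x + y * Complex.I)) := by
    have := integrable_comp_add (f := dilogInv b) (y := y) (h := -η) (w := w)
      (by simpa only [sub_eq_add_neg] using hC.integrable le_rfl hsub (by linarith) hw')
    simpa [sub_eq_add_neg] using this
  rw [hfun] at h2
  calc lineFourier (dilogDiff b η) y w
      = lineFourier (dilogInv b) y w -
          lineFourier (fun z => dilogInv b (z - η * Complex.I)) y w := by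
        unfold lineFourier dilogDiff
        rw [← integral_sub hint1 hint2]
        simp only [sub_mul]
    _ = _ := by
        rw [h2, ← sub_eq_add_neg, h3, sub_mul, one_mul]
        congr 3
        push_cast; ring

/-- The value at the origin of the Fourier integral of the vertical difference. -/
lemma lineFourier_dilogDiff_zero {b : ℝ} (hb : 0 < b) (hb1 : b ≤ 1) {y η : ℝ} (hη : 0 ≤ η)
    (h1 : -((b + b⁻¹) / 2) < y - η) (hy : y < 0) :
    lineFourier (dilogDiff b η) y 0 = -(η * Complex.I) := by
  have hsub : y - η ≤ y := by linarith
  obtain ⟨C, hC⟩ := exists_stripDecay_dilogDiff hb hb1 hη h1 (y₂ := y) (by linarith)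
  have hfi : Integrable fun x : ℝ => dilogDiff b η (x + y * Complex.I) := by
    simpa using hC.integrable le_rfl le_rfl (w := 0) (by simpa) (by simp; linarith)
  have hlim := intervalIntegral_tendsto_integral hfi tendsto_neg_atTop_atBot tendsto_id
  obtain ⟨C', hG⟩ := exists_stripDecay_dilogInv hb h1 hy.le
  have hC' := hG.nonneg hsub
  have hY : η - y < (b + b⁻¹) / 2 := by linarith
  obtain ⟨C₁, hC₁⟩ := exists_norm_dilogInv_sub_one_le hb hY
  have hL : Tendsto (fun T : ℝ => ∫ v in (y - η)..y, dilogInv b ((-T : ℝ) + v * Complex.I)) atTop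
      (𝓝 ((y - (y - η) : ℝ) * 1)) := by
    refine tendsto_verticalIntegral hsub (B := fun T => C₁ * Real.exp (-(2 * ctrHeight b * T)))
      ?_ (fun z hz hz' => (hG.diff z hz hz').continuousAt) ?_
    · rw [← mul_zero C₁]
      exact (Real.tendsto_exp_neg_atTop_nhds_zero.comp (tendsto_id.const_mul_atTop
        (by have := ctrHeight_pos hb; positivity))).const_mul C₁
    · filter_upwards [eventually_ge_atTop 0] with T hT v hv hv'
      have := hC₁ ((-T : ℝ) + v * Complex.I)
        (by simpa using abs_le.mpr ⟨by linarith, by linarith⟩) (by simpa)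
      refine this.trans (le_of_eq ?_)
      simp
  have hR : Tendsto (fun T : ℝ => ∫ v in (y - η)..y, dilogInv b ((T : ℝ) + v * Complex.I)) atTop
      (𝓝 ((y - (y - η) : ℝ) * 0)) := by
    refine tendsto_verticalIntegral hsub (u := fun T => T)
      (B := fun T => C' * Real.exp (-(2 * π * (-y) * T)))
      ?_ (fun z hz hz' => (hG.diff z hz hz').continuousAt) ?_
    · rw [← mul_zero C']
      refine (Real.tendsto_exp_neg_atTop_nhds_zero.comp (tendsto_id.const_mul_atTop ?_)).const_mul C'
      have : 0 < -y := by linarith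
      positivity
    · filter_upwards [eventually_ge_atTop 0] with T hT v hv hv'
      have := hG.right (T + v * Complex.I) (by simpa using hv) (by simpa) (by simpa)
      rw [sub_zero]
      refine this.trans ?_
      gcongr
      simp
      nlinarith [mul_le_mul_of_nonneg_left hv' (mul_nonneg pi_pos.le hT)]
  have hrect : ∀ T : ℝ, ∫ x in -T..T, dilogDiff b η (x + y * Complex.I) =
      -(Complex.I * (∫ v in (y - η)..y, dilogInv b ((-T : ℝ) + v * Complex.I)) -
        Complex.I * ∫ v in (y - η)..y, dilogInv b ((T : ℝ) + v * Complex.I)) := fun T => by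
    rw [← intervalIntegral_line_sub hsub hG.diff T, neg_sub,
      ← intervalIntegral.integral_sub ((hG.continuous hsub le_rfl).intervalIntegrable _ _)
        ((hG.continuous le_rfl hsub).intervalIntegrable _ _)]
    refine intervalIntegral.integral_congr fun x _ => ?_
    simp only [dilogDiff]
    congr 2
    push_cast; ring
  have hlim2 := (((hL.const_mul Complex.I).sub (hR.const_mul Complex.I)).neg).congr
    fun T => (hrect T).symm
  have := tendsto_nhds_unique hlim hlim2
  simp only [lineFourier, mul_zero, zero_mul, Complex.exp_zero, mul_one]
  rw [this]
  push_cast; ring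

lemma sum_dilogDiff (b η : ℝ) (n : ℕ) (z : ℂ) :
    ∑ j ∈ Finset.range n, dilogDiff b η (z + ((j + 1) * η : ℝ) * Complex.I) =
      dilogInv b (z + (n * η : ℝ) * Complex.I) - dilogInv b z := by
  have := Finset.sum_range_sub (fun j : ℕ => dilogInv b (z + (j * η : ℝ) * Complex.I)) n
  simp only [Nat.cast_zero, zero_mul, Complex.ofReal_zero, add_zero] at this
  rw [← this]
  refine Finset.sum_congr rfl fun j _ => ?_
  rw [dilogDiff]
  congr 2
  · push_cast; ring
  · push_cast; ring

/-- The functional equation of the reciprocal dilogarithm on the Fourier side. -/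
lemma lineFourier_dilogInv_sub {b : ℝ} (hb : 0 < b) (hb1 : b ≤ 1) {y η : ℝ} {n : ℕ} (hη : 0 ≤ η)
    (hn : n * η = b) (h1 : -((b + b⁻¹) / 2) < y - η) {w : ℂ}
    (hw : y + b < w.im) (hw' : w.im < b / 2) :
    Complex.exp (Complex.I * π * b ^ 2) * lineFourier (dilogInv b) y (w - b * Complex.I) =
      (∑ j ∈ Finset.range n, Complex.exp (2 * π * ((j + 1) * η : ℝ) * w)) *
        lineFourier (dilogDiff b η) y w := by
  obtain ⟨C, hC⟩ := exists_stripDecay_dilogDiff hb hb1 hη h1 (y₂ := y + b) (by linarith)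
  have hj : ∀ j ∈ Finset.range n, ((j : ℝ) + 1) * η ≤ b := fun j hj => by
    rw [← hn]
    gcongr
    exact_mod_cast Finset.mem_range.mp hj
  have hj0 : ∀ j : ℕ, 0 ≤ ((j : ℝ) + 1) * η := fun j => by positivity
  have hfi : ∀ j ∈ Finset.range n, Integrable fun x : ℝ =>
      dilogDiff b η (x + y * Complex.I + (((j : ℝ) + 1) * η : ℝ) * Complex.I) *
      Complex.exp (2 * π * Complex.I * w * (x + y * Complex.I)) := fun j hjn =>
    integrable_comp_add (hC.integrable (by linarith [hj0 j]) (by linarith [hj j hjn])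
      (by linarith [hj j hjn]) hw')
  rw [Finset.sum_mul]
  have hterm : ∀ j ∈ Finset.range n, Complex.exp (2 * π * ((j + 1) * η : ℝ) * w) *
      lineFourier (dilogDiff b η) y w =
      lineFourier (fun z => dilogDiff b η (z + (((j : ℝ) + 1) * η : ℝ) * Complex.I)) y w :=
    fun j hjn => by
      rw [lineFourier_comp_add, hC.lineFourier_eq' le_rfl (z₂ := y + (j + 1) * η)
        (by linarith [hj0 j]) (by linarith [hj j hjn]) (by linarith [hj j hjn]) hw']
  rw [Finset.sum_congr rfl hterm]
  unfold lineFourier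
  rw [← integral_finsetSum _ hfi, ← integral_const_mul]
  refine integral_congr_ae (ae_of_all _ fun x => ?_)
  simp only
  rw [← Finset.sum_mul, sum_dilogDiff, hn]
  have him : (x + y * Complex.I + Complex.I * b / 2 : ℂ).im = y + b / 2 := by simp
  have hs := dilogInv_shift hb (z := x + y * Complex.I + Complex.I * b / 2)
    (by rw [him, abs_of_neg (by linarith)]; linarith)
  rw [show (x + y * Complex.I + Complex.I * b / 2 + Complex.I * b / 2 : ℂ) =
    x + y * Complex.I + b * Complex.I by ring, add_sub_cancel_right] at hs
  rw [hs, add_mul, one_mul, add_sub_cancel_left, mul_left_comm, ← Complex.exp_add,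
    mul_comm (Complex.exp _) (dilogInv b _), mul_assoc (dilogInv b _), ← Complex.exp_add]
  congr 2
  linear_combination (-2 * π * b * (x + y * Complex.I) : ℂ) * Complex.I_mul_I

/-- A geometric sum of exponentials. -/
def shiftSum (η : ℝ) (n : ℕ) (w : ℂ) : ℂ :=
  ∑ j ∈ Finset.range n, Complex.exp (2 * π * ((j + 1) * η : ℝ) * w)

lemma shiftSum_mul (η : ℝ) (n : ℕ) (w : ℂ) :
    (1 - Complex.exp (-(2 * π * η * w))) * shiftSum η n w =
      Complex.exp (2 * π * (n * η : ℝ) * w) - 1 := by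
  have := Finset.sum_range_sub (fun j : ℕ => Complex.exp (2 * π * (j * η : ℝ) * w)) n
  simp only [Nat.cast_zero, zero_mul, Complex.ofReal_zero, mul_zero, Complex.exp_zero] at this
  rw [← this, shiftSum, Finset.mul_sum]
  refine Finset.sum_congr rfl fun j _ => ?_
  rw [sub_mul, one_mul, ← Complex.exp_add]
  congr 2
  · push_cast; ring
  · push_cast; ring

lemma norm_shiftSum_le {η : ℝ} (hη : 0 ≤ η) (n : ℕ) (w : ℂ) :
    ‖shiftSum η n w‖ ≤ n * Real.exp (2 * π * (n * η) * max w.re 0) := by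
  refine (norm_sum_le_of_le _ (f := fun j : ℕ => Complex.exp (2 * π * ((j + 1) * η : ℝ) * w))
    (n := fun _ => Real.exp (2 * π * (n * η) * max w.re 0)) fun j hj => ?_).trans (by simp)
  rw [Complex.norm_exp]
  have h1 : (2 * π * ((j + 1) * η : ℝ) * w : ℂ).re = 2 * π * ((j + 1) * η) * w.re := by
    rw [show (2 * π * ((j + 1) * η : ℝ) * w : ℂ) = (2 * π * ((j + 1) * η) : ℝ) * w by push_cast; ring,
      Complex.re_ofReal_mul]
  rw [h1]
  have h2 : (j : ℝ) + 1 ≤ n := by exact_mod_cast Finset.mem_range.mp hj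
  have h3 : w.re ≤ max w.re 0 := le_max_left _ _
  have h4 : 0 ≤ max w.re 0 := le_max_right _ _
  refine Real.exp_le_exp.mpr ?_
  calc 2 * π * ((j + 1) * η) * w.re ≤ 2 * π * ((j + 1) * η) * max w.re 0 := by gcongr
    _ ≤ _ := by gcongr

lemma differentiable_shiftSum (η : ℝ) (n : ℕ) : Differentiable ℂ (shiftSum η n) := by
  unfold shiftSum
  fun_prop

/-- The periodic function whose constancy yields the Fourier transform of `dilogInv`. -/
def fourierQuot (b η y : ℝ) (n : ℕ) (w : ℂ) : ℂ :=
  lineFourier (dilogDiff b η) y w * shiftSum η n w *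
    dilogInv b (w + ((b⁻¹ - b) / 2 : ℝ) * Complex.I) *
    Complex.exp (-(2 * π * ((b + b⁻¹) / 2 : ℝ) * w))

lemma fourierQuot_eq_of_neg {b : ℝ} (hb : 0 < b) (hb1 : b ≤ 1) {y η : ℝ} {n : ℕ} (hη : 0 ≤ η)
    (hn : n * η = b) (h1 : -((b + b⁻¹) / 2) < y - η) {w : ℂ} (hw : y < w.im) (hw' : w.im < 0) :
    fourierQuot b η y n w = -(lineFourier (dilogInv b) y w *
      dilogInv b (w + ((b + b⁻¹) / 2 : ℝ) * Complex.I) *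
      Complex.exp (-(2 * π * ((b + b⁻¹) / 2 : ℝ) * w))) := by
  have hb2 : b ≤ b⁻¹ := hb1.trans ((one_le_inv₀ hb).mpr hb1)
  have h2 := shiftSum_mul η n w
  rw [hn] at h2
  rw [fourierQuot, lineFourier_dilogDiff hb hη h1 hw hw', dilogInv_add_c hb hw' (by linarith),
    show (2 * π * (b * w) : ℂ) = 2 * π * b * w by ring]
  linear_combination lineFourier (dilogInv b) y w *
    dilogInv b (w + ((b⁻¹ - b) / 2 : ℝ) * Complex.I) *
    Complex.exp (-(2 * π * ((b + b⁻¹) / 2 : ℝ) * w)) * h2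

lemma fourierQuot_periodic {b : ℝ} (hb : 0 < b) (hb1 : b ≤ 1) {y η : ℝ} {n : ℕ} (hη : 0 ≤ η)
    (hn : n * η = b) (h1 : -((b + b⁻¹) / 2) < y - η) {w : ℂ}
    (hw : y + b < w.im) (hw' : w.im < b / 2) :
    fourierQuot b η y n (w - b * Complex.I) = fourierQuot b η y n w := by
  have him : (w - b * Complex.I).im = w.im - b := by simp
  have h2 := lineFourier_dilogInv_sub hb hb1 hη hn h1 hw hw'
  change _ = shiftSum η n w * _ at h2
  have hbc : (b : ℂ) ≠ 0 := by exact_mod_cast hb.ne'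
  have h3 : Complex.exp (-(2 * π * ((b + b⁻¹) / 2 : ℝ) * (w - b * Complex.I))) =
      -(Complex.exp (Complex.I * π * b ^ 2) *
        Complex.exp (-(2 * π * ((b + b⁻¹) / 2 : ℝ) * w))) := by
    rw [← Complex.exp_add, ← Complex.exp_add_pi_mul_I]
    congr 1
    push_cast
    field_simp
    ring
  rw [fourierQuot_eq_of_neg hb hb1 hη hn h1 (by rw [him]; linarith) (by rw [him]; linarith),
    fourierQuot, h3, show w - b * Complex.I + ((b + b⁻¹) / 2 : ℝ) * Complex.I =
      w + ((b⁻¹ - b) / 2 : ℝ) * Complex.I by push_cast; ring]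
  linear_combination dilogInv b (w + ((b⁻¹ - b) / 2 : ℝ) * Complex.I) *
    Complex.exp (-(2 * π * ((b + b⁻¹) / 2 : ℝ) * w)) * h2

lemma abs_im_add_lt {b : ℝ} (hb : 0 < b) (hb1 : b ≤ 1) {v : ℝ} (h1 : -((b + b⁻¹) / 2) < v)
    (h2 : v < b / 2) : |v + (b⁻¹ - b) / 2| < (b + b⁻¹) / 2 := by
  have hb2 : b ≤ b⁻¹ := hb1.trans ((one_le_inv₀ hb).mpr hb1)
  exact abs_lt.mpr ⟨by linarith, by linarith⟩

lemma differentiableAt_fourierQuot {b : ℝ} (hb : 0 < b) (hb1 : b ≤ 1) {y η : ℝ} (n : ℕ)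
    (hη : 0 ≤ η) (h1 : -((b + b⁻¹) / 2) < y - η) {w : ℂ} (hw : y < w.im) (hw' : w.im < b / 2) :
    DifferentiableAt ℂ (fourierQuot b η y n) w := by
  obtain ⟨C, hC⟩ := exists_stripDecay_dilogDiff hb hb1 hη h1 (y₂ := y) (by linarith)
  refine (((hC.differentiableAt le_rfl le_rfl hw hw').mul
    (differentiable_shiftSum η n w)).mul ?_).mul (by fun_prop)
  refine DifferentiableAt.comp (g := dilogInv b) w (differentiableAt_dilogInv hb ?_)
    (differentiableAt_id.add_const _)
  have := abs_im_add_lt hb hb1 (v := w.im) (by linarith) hw'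
  simpa using this

lemma norm_fourierQuot_le {b C A y' μ η y : ℝ} {n : ℕ} (hη : 0 ≤ η) (hn : n * η = b) {w : ℂ}
    (hA : 0 ≤ A) (hK : ‖lineFourier (dilogDiff b η) y w‖ ≤ A * Real.exp (-(2 * π * w.re * y')))
    (hG : ‖dilogInv b (w + ((b⁻¹ - b) / 2 : ℝ) * Complex.I)‖ ≤
      C * Real.exp (2 * π * max w.re 0 * (w.im + (b⁻¹ - b) / 2)))
    (hμ₁ : y' + (b + b⁻¹) / 2 ≤ μ) (hμ₂ : w.im - y' ≤ μ) :
    ‖fourierQuot b η y n w‖ ≤ A * n * C * Real.exp (2 * π * μ * |w.re|) := by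
  have hS := norm_shiftSum_le hη n w
  rw [hn] at hS
  have hC : 0 ≤ C := nonneg_of_mul_nonneg_left ((norm_nonneg _).trans hG) (Real.exp_pos _)
  have hE : ‖Complex.exp (-(2 * π * ((b + b⁻¹) / 2 : ℝ) * w))‖ =
      Real.exp (-(2 * π * ((b + b⁻¹) / 2) * w.re)) := by
    rw [Complex.norm_exp, Complex.neg_re, show (2 * π * ((b + b⁻¹) / 2 : ℝ) * w : ℂ) =
      (2 * π * ((b + b⁻¹) / 2) : ℝ) * w by push_cast; ring, Complex.re_ofReal_mul]
  rw [fourierQuot, norm_mul, norm_mul, norm_mul, hE]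
  calc _ ≤ A * Real.exp (-(2 * π * w.re * y')) * (n * Real.exp (2 * π * b * max w.re 0)) *
        (C * Real.exp (2 * π * max w.re 0 * (w.im + (b⁻¹ - b) / 2))) *
        Real.exp (-(2 * π * ((b + b⁻¹) / 2) * w.re)) := by gcongr
    _ = A * n * C * Real.exp (-(2 * π * w.re * y') + 2 * π * b * max w.re 0 +
        2 * π * max w.re 0 * (w.im + (b⁻¹ - b) / 2) + -(2 * π * ((b + b⁻¹) / 2) * w.re)) := by
      rw [Real.exp_add, Real.exp_add, Real.exp_add]; ring
    _ ≤ _ := by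
      gcongr
      rcases le_total w.re 0 with hu | hu
      · rw [max_eq_right hu, abs_of_nonpos hu]
        nlinarith [mul_le_mul_of_nonneg_left hμ₁ (mul_nonneg pi_pos.le (neg_nonneg.mpr hu))]
      · rw [max_eq_left hu, abs_of_nonneg hu]
        nlinarith [mul_le_mul_of_nonneg_left hμ₂ (mul_nonneg pi_pos.le hu)]

lemma exists_norm_fourierQuot_le {b : ℝ} (hb : 0 < b) (hb1 : b ≤ 1) {y η d : ℝ} {n : ℕ}
    (hη : 0 ≤ η) (hn : n * η = b) (h1 : -((b + b⁻¹) / 2) < y - η) (hd : 0 < d) (hdb : d < b / 2)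
    (hdy : y + d + b < b / 2) :
    ∃ C m : ℝ, m < 2 * π / b ∧ ∀ w : ℂ, y + d ≤ w.im → w.im ≤ y + d + b →
      ‖fourierQuot b η y n w‖ ≤ C * Real.exp (m * |w.re|) := by
  have hb2 : b ≤ b⁻¹ := hb1.trans ((one_le_inv₀ hb).mpr hb1)
  obtain ⟨C, hC⟩ := exists_stripDecay_dilogDiff hb hb1 hη h1 (y₂ := y + b / 2) (by linarith)
  have hyy : y ≤ y + b / 2 := by linarith
  have hC0 := hC.nonneg hyy
  set e := min d (b / 2 - (y + d + b)) with he
  have he0 : 0 < e := lt_min hd (by linarith)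
  have he1 : e ≤ d := min_le_left _ _
  have he2 : e ≤ b / 2 - (y + d + b) := min_le_right _ _
  set A : ℝ := ∫ x : ℝ, C * Real.exp (-(2 * π * e * |x|)) with hA
  have hA0 : 0 ≤ A := integral_nonneg fun x => by positivity
  set δ := (b⁻¹ - b) / 2 with hδ
  set Y := max |y + d + δ| |y + d + b + δ| with hY
  have hYlt : Y < (b + b⁻¹) / 2 := max_lt (abs_im_add_lt hb hb1 (by linarith) (by linarith))
    (abs_im_add_lt hb hb1 (by linarith) (by linarith))
  obtain ⟨C', hG⟩ := exists_norm_dilogInv_le hb hYlt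
  set μ := max (d + b / 2) (y + b / 2 + (b + b⁻¹) / 2) with hμ
  have hμ1 : d + b / 2 ≤ μ := le_max_left _ _
  have hμ2 : y + b / 2 + (b + b⁻¹) / 2 ≤ μ := le_max_right _ _
  have hμlt : μ < b⁻¹ := max_lt (by linarith) (by linarith)
  refine ⟨A * n * C', 2 * π * μ, ?_, fun w hw hw' => ?_⟩
  · rw [div_eq_mul_inv]
    gcongr
  · have him : (w + δ * Complex.I).im = w.im + δ := by simp
    have hre : (w + δ * Complex.I).re = w.re := by simp
    have hGw := hG (w + δ * Complex.I) (by
      rw [him]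
      exact abs_le_max_abs_abs (by linarith) (by linarith))
    rw [him, hre] at hGw
    rcases le_total w.im (y + b / 2 + d) with hcase | hcase
    · exact norm_fourierQuot_le hη hn hA0
        (hC.norm_le le_rfl hyy he0 (by linarith) (by linarith)) hGw (by linarith) (by linarith)
    · have hK := hC.norm_le hyy le_rfl he0 (w := w) (by linarith) (by linarith)
      rw [← hC.lineFourier_eq hyy (by linarith) (by linarith)] at hK
      exact norm_fourierQuot_le hη hn hA0 hK hGw (by linarith) (by linarith)

lemma lineFourier_dilogInv_of_le_one {b : ℝ} (hb : 0 < b) (hb1 : b ≤ 1) {y : ℝ}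
    (hy : -((b + b⁻¹) / 2) < y) {w : ℂ} (hw : y < w.im) (hw' : w.im < 0) :
    lineFourier (dilogInv b) y w * dilogInv b (w + ((b + b⁻¹) / 2 : ℝ) * Complex.I) =
      Complex.I * (b * dilogInv b (((b⁻¹ - b) / 2 : ℝ) * Complex.I)) *
        Complex.exp (2 * π * ((b + b⁻¹) / 2 : ℝ) * w) := by
  have hbi : 0 < b⁻¹ := inv_pos.mpr hb
  set κ := (b + b⁻¹) / 2 with hκ
  set y₀ := (-κ + min y (-(b / 2))) / 2 with hy₀
  have hmin : -κ < min y (-(b / 2)) := lt_min hy (by linarith)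
  have hmin1 : min y (-(b / 2)) ≤ y := min_le_left _ _
  have hmin2 : min y (-(b / 2)) ≤ -(b / 2) := min_le_right _ _
  have h0κ : 0 < y₀ + κ := by linarith
  obtain ⟨n, hn⟩ := exists_nat_gt (b / (y₀ + κ))
  have hn0 : (0 : ℝ) < n := lt_of_le_of_lt (by positivity) hn
  set η := b / n with hηdef
  have hη : 0 ≤ η := by positivity
  have hnη : n * η = b := by rw [hηdef]; field_simp
  have h1 : -κ < y₀ - η := by
    have : η < y₀ + κ := by
      rw [hηdef, div_lt_iff₀ hn0]
      rwa [div_lt_iff₀ h0κ, mul_comm] at hn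
    linarith
  set d := min (b / 2) (-y₀ - b / 2) / 2 with hd
  have hd0 : 0 < min (b / 2) (-y₀ - b / 2) := lt_min (by linarith) (by linarith)
  have hd1 := min_le_left (b / 2) (-y₀ - b / 2)
  have hd2 := min_le_right (b / 2) (-y₀ - b / 2)
  obtain ⟨C, m, hm, hbd⟩ := exists_norm_fourierQuot_le hb hb1 (d := d) hη hnη h1 (by linarith)
    (by linarith) (by linarith)
  have key : fourierQuot b η y₀ n w = fourierQuot b η y₀ n 0 :=
    eq_of_periodic_strip' hb (α := y₀) (β := b / 2) (γ := y₀ + d) (by linarith) (by linarith)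
      (fun z hz hz' => differentiableAt_fourierQuot hb hb1 n hη h1 hz hz')
      (fun z hz hz' => fourierQuot_periodic hb hb1 hη hnη h1 hz hz') hm hbd
      (by linarith) (by linarith) (by simp; linarith) (by simp; linarith)
  have hzero : fourierQuot b η y₀ n 0 =
      -(Complex.I * (b * dilogInv b (((b⁻¹ - b) / 2 : ℝ) * Complex.I))) := by
    have hnc : (n * η : ℂ) = b := by exact_mod_cast hnη
    rw [fourierQuot, lineFourier_dilogDiff_zero hb hb1 hη h1 (by linarith)]
    simp only [shiftSum, mul_zero, Complex.exp_zero, Finset.sum_const, Finset.card_range,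
      nsmul_eq_mul, mul_one, neg_zero, zero_add]
    rw [← hnc]
    ring
  obtain ⟨C', hG⟩ := exists_stripDecay_dilogInv hb (y₁ := y₀) (y₂ := y) (by linarith) (by linarith)
  rw [fourierQuot_eq_of_neg hb hb1 hη hnη h1 (by linarith) hw',
    hG.lineFourier_eq (by linarith) hw hw', hzero, neg_inj] at key
  rw [← key, mul_assoc _ (Complex.exp _), ← Complex.exp_add, neg_add_cancel, Complex.exp_zero,
    mul_one]

/-- The Fourier transform of the reciprocal of Faddeev's quantum dilogarithm. -/
theorem lineFourier_dilogInv {b : ℝ} (hb : 0 < b) {y : ℝ}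
    (hy : -((b + b⁻¹) / 2) < y) {w : ℂ} (hw : y < w.im) (hw' : w.im < 0) :
    lineFourier (dilogInv b) y w * dilogInv b (w + ((b + b⁻¹) / 2 : ℝ) * Complex.I) =
      Complex.exp (Complex.I * π * (((b + b⁻¹) / 2 : ℝ) ^ 2 / 3 + 1 / 12)) *
        Complex.exp (2 * π * ((b + b⁻¹) / 2 : ℝ) * w) := by
  wlog hb1 : b ≤ 1 generalizing b
  · have hinv : dilogInv b⁻¹ = dilogInv b := funext fun z => dilogInv_inv b z
    have hsum : b⁻¹ + b⁻¹⁻¹ = b + b⁻¹ := by rw [inv_inv, add_comm]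
    have := this (inv_pos.mpr hb) (by rwa [hsum]) (inv_le_one_of_one_le₀ (le_of_not_ge hb1))
    rwa [hsum, hinv] at this
  rw [lineFourier_dilogInv_of_le_one hb hb1 hy hw hw', dilogInv_special hb]
  congr 1
  nth_rw 1 [← Complex.exp_pi_div_two_mul_I]
  rw [← Complex.exp_add]
  congr 1
  ring

/-- The function `ψ_{a,c}` on the real line in terms of the reciprocal dilogarithm. -/
lemma psiF_eq_dilogInv {b : ℝ} (hb : 0 < b) {a c : ℝ} (h0 : 0 < a + c) (h1 : a + c < 1 / 2)
    (t : ℝ) : psiF b a c t =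
      dilogInv b (t + (-(2 * ((b + b⁻¹) / 2) * (a + c)) : ℝ) * Complex.I) *
      Complex.exp (4 * π * ((b + b⁻¹) / 2 : ℝ) * a *
          (t - ((b + b⁻¹) / 2 : ℝ) * (a + c) * Complex.I) +
        π * Complex.I * ((b + b⁻¹) / 2 : ℝ) ^ 2 * (4 * (a - c) + 1) / 6) := by
  have hbi : 0 < b⁻¹ := inv_pos.mpr hb
  set κ := (b + b⁻¹) / 2 with hκ
  have hκ0 : 0 < κ := by positivity
  have hc : cB b = κ * Complex.I := by rw [cB, hκ]; push_cast; ring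
  have harg : (t - 2 * cB b * (a + c) : ℂ) = t + (-(2 * κ * (a + c)) : ℝ) * Complex.I := by
    rw [hc]; push_cast; ring
  have him : (t + (-(2 * κ * (a + c)) : ℝ) * Complex.I : ℂ).im = -(2 * κ * (a + c)) := by simp
  have hPhi : (Phi b (t + (-(2 * κ * (a + c)) : ℝ) * Complex.I))⁻¹ =
      dilogInv b (t + (-(2 * κ * (a + c)) : ℝ) * Complex.I) := by
    rw [Phi, if_neg, if_neg, PhiS_eq_exp_dilogLog, dilogInv, Complex.exp_neg]
    · rw [him, ← hκ]; nlinarith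
    · rw [him, ← hκ]; nlinarith
  rw [psiF, harg, hPhi, mul_assoc, ← Complex.exp_add, hc]
  congr 2
  linear_combination (-4 * π * κ * a * t + 4 * π * κ ^ 2 * a * (a + c) * Complex.I -
    π * Complex.I * κ ^ 2 * (4 * (a - c) + 1) / 6 : ℂ) * Complex.I_mul_I

/-- The Fourier transform of `ψ_{b,c}` is, up to a phase, the reflected conjugate of `ψ_{a,c}`. -/
lemma psiT_eq_conj_psiF {b : ℝ} (hb : 0 < b) {a c : ℝ} (ha : 0 < a) (hc : 0 < c)
    (hac : 0 < 1 / 2 - a - c) (s : ℝ) :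
    psiT b (1 / 2 - a - c) c s =
      Complex.exp (π * Complex.I / 12) * (starRingEnd ℂ) (psiF b a c ((-s : ℝ) : ℂ)) := by
  have hbi : 0 < b⁻¹ := inv_pos.mpr hb
  rw [psiF_eq_dilogInv hb (by linarith) (by linarith)]
  have hψ := fun t : ℝ => psiF_eq_dilogInv hb (a := 1 / 2 - a - c) (c := c)
    (by linarith) (by linarith) t
  set κ := (b + b⁻¹) / 2 with hκ
  have hκ0 : 0 < κ := by positivity
  set y := -(2 * κ * (1 / 2 - a - c + c)) with hy
  set w : ℂ := -s - 2 * κ * (1 / 2 - a - c : ℝ) * Complex.I with hw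
  have hwim : w.im = -(2 * κ * (1 / 2 - a - c)) := by
    rw [hw, show (2 * κ * (1 / 2 - a - c : ℝ) * Complex.I : ℂ) =
      (2 * κ * (1 / 2 - a - c) : ℝ) * Complex.I by push_cast; ring]
    simp
  have hF := lineFourier_dilogInv hb (y := y) (w := w) (by rw [← hκ]; nlinarith)
    (by rw [hwim]; nlinarith) (by rw [hwim]; nlinarith)
  rw [← hκ] at hF
  have hpsiT : psiT b (1 / 2 - a - c) c s = lineFourier (dilogInv b) y w *
      Complex.exp (2 * π * w * y - 4 * π * κ ^ 2 * (1 / 2 - a - c) * (1 / 2 - a) * Complex.I +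
        π * Complex.I * κ ^ 2 * (4 * (1 / 2 - a - 2 * c) + 1) / 6) := by
    rw [psiT, lineFourier, ← integral_mul_const]
    refine integral_congr_ae (ae_of_all _ fun t => ?_)
    simp only
    rw [hψ, mul_assoc (dilogInv b _), ← Complex.exp_add, mul_assoc (dilogInv b _), ← Complex.exp_add]
    congr 2
    rw [hw]
    push_cast
    linear_combination (4 * π * κ * (1 / 2 - a - c) * t +
      2 * π * y * (s + 2 * κ * (1 / 2 - a - c) * Complex.I) : ℂ) * Complex.I_mul_I
  have harg : (starRingEnd ℂ) (((-s : ℝ) : ℂ) + (-(2 * κ * (a + c)) : ℝ) * Complex.I) =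
      w + κ * Complex.I := by
    rw [map_add, map_mul, Complex.conj_I, Complex.conj_ofReal, Complex.conj_ofReal, hw]
    push_cast; ring
  have hG := dilogInv_ne_zero b (w + κ * Complex.I)
  rw [hpsiT, map_mul, conj_dilogInv, harg, ← Complex.exp_conj]
  rw [eq_div_iff hG |>.mpr hF, div_mul_eq_mul_div, ← Complex.exp_add, ← Complex.exp_add,
    mul_left_comm, ← Complex.exp_add, div_eq_inv_mul]
  congr 2
  simp only [map_add, map_mul, map_sub, map_div₀, Complex.conj_I, Complex.conj_ofReal, map_pow,
    map_one, map_ofNat]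
  rw [hw, hy]
  push_cast
  ring

open FourierTransform in
/-- The Poisson summation formula for exponentially decaying functions. -/
lemma tsum_eq_tsum_fourier_of_exp_decay {f : ℝ → ℂ} (hf : Continuous f) {C₁ d₁ C₂ d₂ : ℝ}
    (hd₁ : 0 < d₁) (h₁ : ∀ t, ‖f t‖ ≤ C₁ * Real.exp (-(d₁ * |t|))) (hd₂ : 0 < d₂)
    (h₂ : ∀ t, ‖𝓕 f t‖ ≤ C₂ * Real.exp (-(d₂ * |t|))) (x : ℝ) :
    ∑' n : ℤ, f (x + n) = ∑' n : ℤ, 𝓕 f n * fourier n (x : UnitAddCircle) := by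
  have key : ∀ {g : ℝ → ℂ} {C d : ℝ}, 0 < d → (∀ t, ‖g t‖ ≤ C * Real.exp (-(d * |t|))) →
      g =O[cocompact ℝ] fun t : ℝ => |t| ^ (-2 : ℝ) := by
    intro g C d hd h
    have h1 : g =O[cocompact ℝ] fun t : ℝ => Real.exp (-d * |t|) :=
      Asymptotics.IsBigO.of_bound C (Eventually.of_forall fun t => by
        rw [Real.norm_of_nonneg (Real.exp_pos _).le, neg_mul]
        exact h t)
    exact h1.trans ((isLittleO_exp_neg_mul_rpow_atTop hd (-2)).isBigO.comp_tendsto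
      (tendsto_norm_cocompact_atTop (E := ℝ)))
  exact Real.tsum_eq_tsum_fourier_of_rpow_decay hf one_lt_two (key hd₁ h₁) (key hd₂ h₂) x

lemma continuous_psiF {b : ℝ} (hb : 0 < b) {a c : ℝ} (h0 : 0 < a + c) (h1 : a + c < 1 / 2) :
    Continuous fun t : ℝ => psiF b a c t := by
  have hbi : 0 < b⁻¹ := inv_pos.mpr hb
  simp_rw [psiF_eq_dilogInv hb h0 h1]
  refine Continuous.mul ?_ (by fun_prop)
  refine continuous_line_of_differentiableAt fun t => differentiableAt_dilogInv hb ?_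
  have him : (t + (-(2 * ((b + b⁻¹) / 2) * (a + c)) : ℝ) * Complex.I : ℂ).im =
    -(2 * ((b + b⁻¹) / 2) * (a + c)) := by simp
  have hκ0 : 0 < (b + b⁻¹) / 2 := by positivity
  rw [him, abs_neg, abs_of_pos (by positivity)]
  nlinarith

lemma exists_norm_psiF_le {b : ℝ} (hb : 0 < b) {a c : ℝ} (ha : 0 < a) (hc : 0 < c)
    (hac : a + c < 1 / 2) :
    ∃ C d : ℝ, 0 < d ∧ ∀ t : ℝ, ‖psiF b a c t‖ ≤ C * Real.exp (-(d * |t|)) := by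
  have hbi : 0 < b⁻¹ := inv_pos.mpr hb
  have hψ := psiF_eq_dilogInv hb (a := a) (c := c) (by linarith) hac
  obtain ⟨C, hC⟩ := exists_stripDecay_dilogInv hb
    (y₁ := -(2 * ((b + b⁻¹) / 2) * (a + c))) (y₂ := -(2 * ((b + b⁻¹) / 2) * (a + c)))
    (by have : 0 < (b + b⁻¹) / 2 := by positivity
        nlinarith) (by rw [neg_nonpos]; positivity)
  set κ := (b + b⁻¹) / 2 with hκ
  have hκ0 : 0 < κ := by positivity
  have hm : 0 < min a c := lt_min ha hc
  refine ⟨C, 4 * π * κ * min a c, by positivity, fun t => ?_⟩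
  have hE : ‖Complex.exp (4 * π * κ * a * (t - κ * (a + c) * Complex.I) +
      π * Complex.I * κ ^ 2 * (4 * (a - c) + 1) / 6)‖ = Real.exp (4 * π * κ * a * t) := by
    rw [Complex.norm_exp, show (4 * π * κ * a * (t - κ * (a + c) * Complex.I) +
      π * Complex.I * κ ^ 2 * (4 * (a - c) + 1) / 6 : ℂ) = (4 * π * κ * a * t : ℝ) +
      (-(4 * π * κ * a * κ * (a + c)) + π * κ ^ 2 * (4 * (a - c) + 1) / 6 : ℝ) * Complex.I by
        push_cast; ring]
    simp only [Complex.add_re, Complex.ofReal_re, Complex.re_ofReal_mul, Complex.I_re, mul_zero,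
      add_zero]
  rw [hψ, norm_mul, hE]
  have h1 : min a c ≤ a := min_le_left _ _
  have h2 : min a c ≤ c := min_le_right _ _
  have hp : 0 < 4 * π * κ := by positivity
  refine norm_le_exp_neg_abs (hC.bound_left le_rfl le_rfl) (hC.bound_right le_rfl le_rfl) ?_ ?_ t
  · have := mul_le_mul_of_nonneg_left h1 hp.le
    linarith
  · have := mul_le_mul_of_nonneg_left h2 hp.le
    linarith

lemma conj_psiT {b : ℝ} (hb : 0 < b) {a c : ℝ} (ha : 0 < a) (hc : 0 < c)
    (hac : 0 < 1 / 2 - a - c) (s : ℝ) :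
    (starRingEnd ℂ) (psiT b (1 / 2 - a - c) c s) =
      Complex.exp (-(π * Complex.I / 12)) * psiF b a c ((-s : ℝ) : ℂ) := by
  rw [psiT_eq_conj_psiF hb ha hc hac, map_mul, Complex.conj_conj, ← Complex.exp_conj]
  congr 2
  simp only [map_mul, map_div₀, Complex.conj_I, Complex.conj_ofReal, map_ofNat]
  ring

open FourierTransform in
/-- The Poisson summation formula for `ψ_{a,c}`. -/
lemma tsum_psiT {b : ℝ} (hb : 0 < b) {a c : ℝ} (ha : 0 < a) (hc : 0 < c)
    (hac : 0 < 1 / 2 - a - c) (x u : ℝ) :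
    ∑' n : ℤ, psiT b a c (x + n) * Complex.exp (2 * π * Complex.I * n * u) =
      ∑' n : ℤ, psiF b a c ((u + n : ℝ) : ℂ) *
        Complex.exp (-2 * π * Complex.I * x * (u + n : ℝ)) := by
  set f : ℝ → ℂ := fun t => psiF b a c t * Complex.exp (-2 * π * Complex.I * x * t) with hf
  have hnorm : ∀ t, ‖f t‖ = ‖psiF b a c t‖ := fun t => by
    rw [hf, norm_mul, show (-2 * π * Complex.I * x * t : ℂ) = (-2 * π * x * t : ℝ) * Complex.I by
      push_cast; ring, Complex.norm_exp_ofReal_mul_I, mul_one]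
  have hFf : ∀ ξ, 𝓕 f ξ = psiT b a c (x + ξ) := fun ξ => by
    rw [Real.fourier_real_eq_integral_exp_smul, psiT]
    refine integral_congr_ae (ae_of_all _ fun t => ?_)
    simp only [hf, smul_eq_mul]
    rw [mul_left_comm, ← Complex.exp_add]
    congr 2
    push_cast; ring
  obtain ⟨C₁, d₁, hd₁, h₁⟩ := exists_norm_psiF_le hb ha hc (by linarith)
  obtain ⟨C₂, d₂, hd₂, h₂⟩ := exists_norm_psiF_le hb hac hc (by linarith)
  have hT : ∀ s, ‖psiT b a c s‖ ≤ C₂ * Real.exp (-(d₂ * |s|)) := fun s => by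
    have h3 := psiT_eq_conj_psiF hb hac hc (by linarith) s
    rw [show 1 / 2 - (1 / 2 - a - c) - c = a by ring] at h3
    rw [h3, norm_mul, RCLike.norm_conj, show (π * Complex.I / 12 : ℂ) = (π / 12 : ℝ) * Complex.I by
      push_cast; ring, Complex.norm_exp_ofReal_mul_I, one_mul]
    simpa using h₂ (-s)
  have hC₂ : 0 ≤ C₂ := nonneg_of_mul_nonneg_left ((norm_nonneg _).trans (h₂ 0)) (Real.exp_pos _)
  have key := tsum_eq_tsum_fourier_of_exp_decay (f := f) (x := u)
    (((continuous_psiF hb (by linarith) (by linarith))).mul (by fun_prop)) hd₁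
    (fun t => by rw [hnorm]; exact h₁ t) hd₂
    (C₂ := C₂ * Real.exp (d₂ * |x|)) (fun ξ => by
      rw [hFf]
      refine (hT _).trans ?_
      rw [mul_assoc, ← Real.exp_add]
      gcongr
      have : |ξ| ≤ |x + ξ| + |x| := by
        have := abs_sub (x + ξ) x
        rwa [add_sub_cancel_left] at this
      nlinarith)
  rw [key]
  refine tsum_congr fun n => ?_
  rw [hFf, fourier_coe_apply]
  congr 2
  push_cast; ring

lemma exp_pi_mul_I_mul_int_mul_succ (m : ℤ) : Complex.exp (π * Complex.I * (m * (m + 1))) = 1 := by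
  obtain ⟨k, hk⟩ := Int.even_mul_succ_self m
  have : (m * (m + 1) : ℂ) = k + k := by exact_mod_cast hk
  rw [this, Complex.exp_eq_one_iff]
  exact ⟨k, by ring⟩

end

/-- Lemma 2, eq. (24) of the paper (second tetrahedral symmetry):
`g_{a,c}(x,y) = e^{-iπ/6} conj(g_{b,c}(x-y-1/2, -y)) e^{-πiy/2}` with `b = 1/2 - a - c`. -/
theorem gW_second_symmetry (bb : ℝ) (hbb : 0 < bb) (a c : ℝ)
    (ha : 0 < a) (hc : 0 < c) (hb : 0 < 1 / 2 - a - c) (x y : ℝ) :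
    gW bb a c x y =
      Complex.exp (-π * Complex.I / 6) *
        (starRingEnd ℂ) (gW bb (1 / 2 - a - c) c (x - y - 1 / 2) (-y)) *
        Complex.exp (-π * Complex.I * y / 2) := by
  have hL : gW bb a c x y = Complex.exp (π * Complex.I * (y * x - x ^ 2)) *
      ∑' n : ℤ, psiT bb a c (x + n) *
        Complex.exp (2 * π * Complex.I * n * (y - x + 1 / 2 : ℝ)) := by
    rw [gW, ← tsum_mul_left]
    refine tsum_congr fun m => ?_
    rw [psiT', mul_right_comm, ← Complex.exp_add, mul_left_comm, ← Complex.exp_add, mul_comm,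
      ← mul_one (Complex.exp (-π * _ * _ + _)), ← exp_pi_mul_I_mul_int_mul_succ m,
      ← Complex.exp_add]
    congr 2
    push_cast; ring
  rw [hL, tsum_psiT hbb ha hc hb, gW, Complex.conj_tsum, ← (Equiv.neg ℤ).tsum_eq, ← tsum_mul_left,
    ← tsum_mul_left, ← tsum_mul_right]
  refine tsum_congr fun n => ?_
  rw [psiT', map_mul, map_mul, conj_psiT hbb ha hc hb, ← Complex.exp_conj, ← Complex.exp_conj,
    Equiv.neg_apply, show -(x - y - 1 / 2 + (n : ℝ)) = y - x + 1 / 2 + ((-n : ℤ) : ℝ) by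
      push_cast; ring]
  simp only [map_add, map_mul, map_neg, Complex.conj_I, Complex.conj_ofReal, map_pow, map_ofNat,
    map_intCast]
  generalize psiF bb a c _ = p
  calc _ = p * (Complex.exp (π * Complex.I * (y * x - x ^ 2)) *
        Complex.exp (-2 * π * Complex.I * x * (y - x + 1 / 2 + (-n : ℤ) : ℝ)) *
        Complex.exp (π * Complex.I * ((-n : ℤ) * ((-n : ℤ) + 1)))) := by
        rw [exp_pi_mul_I_mul_int_mul_succ]; ring
    _ = p * (Complex.exp (-π * Complex.I / 6) * Complex.exp (-π * -Complex.I *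
        ((x - y - 1 / 2 + n : ℝ) : ℂ) ^ 2) * Complex.exp (-(π * Complex.I / 12)) *
        Complex.exp (-Complex.I * π * ((-y : ℝ) : ℂ) * ((x - y - 1 / 2 : ℝ) + 2 * n)) *
        Complex.exp (-π * Complex.I * y / 2)) := by
        simp only [← Complex.exp_add]
        congr 2
        push_cast; ring
    _ = _ := by ring
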